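/- Let v : (0,1]² → (0,1] take values in {2^{-k} : k ∈ ℕ} and be Lipschitz with constant at most 1/2 with respect to the dyadic metric on both the domain (0,1]² and the target (0,1], i.e., d(v(p), v(q)) ≤ (1/2) d(p,q) for all p,q ∈ (0,1]². For f a finite linear combination of tensor Haar functions h_I ⊗ h_J over dyadic rectangles I×J ⊆ (0,1]², define H_{v,D} f(x,y) = Σ_{I×J : |J|/|I| ≤ v(x,y)} ⟨f, h_I ⊗ h_J⟩ h_I(x) h_J(y), the sum over all dyadic rectangles I×J in the unit square with |J|/|I| ≤ v(x,y). Then for every p ∈ (1,∞) there is a constant C_p depending only on p such that ‖H_{v,D} f‖_{L^p((0,1]²)} ≤ C_p ‖f‖_{L^p((0,1]²)} for all such f. -/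

import Mathlib

open MeasureTheory
open scoped Classical

/-- The dyadic interval `(m 2^{-n}, (m+1) 2^{-n}] ⊆ (0,1]` (for `m < 2^n`). -/
def dyadicI (n m : ℕ) : Set ℝ := Set.Ioc ((m : ℝ) / 2 ^ n) (((m : ℝ) + 1) / 2 ^ n)

/-- The dyadic distance of two points of `(0,1]`: the length of the smallest dyadic
interval containing both. -/
noncomputable def dyadDist (x y : ℝ) : ℝ :=
  sInf {l : ℝ | ∃ n m : ℕ, m < 2 ^ n ∧ x ∈ dyadicI n m ∧ y ∈ dyadicI n m ∧ l = ((2 : ℝ) ^ n)⁻¹}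

/-- The dyadic distance of two points of `(0,1]²`: the side length of the smallest dyadic
square containing both. -/
noncomputable def dyadDist2 (p q : ℝ × ℝ) : ℝ :=
  sInf {l : ℝ | ∃ n m m' : ℕ, m < 2 ^ n ∧ m' < 2 ^ n ∧
    p.1 ∈ dyadicI n m ∧ q.1 ∈ dyadicI n m ∧ p.2 ∈ dyadicI n m' ∧ q.2 ∈ dyadicI n m' ∧
    l = ((2 : ℝ) ^ n)⁻¹}

/-- The `L²`-normalized Haar function of the dyadic interval indexed by `(n, m)`:
`h_I = |I|^{-1/2} (1_{I_left} - 1_{I_right})`. -/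
noncomputable def haarFn (n m : ℕ) (x : ℝ) : ℝ :=
  (2 : ℝ) ^ ((n : ℝ) / 2) *
    ((dyadicI (n + 1) (2 * m)).indicator (fun _ => (1 : ℝ)) x -
      (dyadicI (n + 1) (2 * m + 1)).indicator (fun _ => (1 : ℝ)) x)

/-- The unit square `(0,1]²`. -/
def unitSq : Set (ℝ × ℝ) := Set.Ioc (0 : ℝ) 1 ×ˢ Set.Ioc (0 : ℝ) 1

/-- The dyadic directional Haar multiplier
`H_{v,D} f(x,y) = Σ_{I×J : |J|/|I| ≤ v(x,y)} ⟨f, h_I ⊗ h_J⟩ h_I(x) h_J(y)`,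
the sum running over all dyadic rectangles `I×J` of the unit square
(indexed by `((nI,mI),(nJ,mJ))`) whose eccentricity `|J|/|I|` is at most `v(x,y)`. -/
noncomputable def dyadicHilbert (v : ℝ × ℝ → ℝ) (f : ℝ × ℝ → ℝ) (q : ℝ × ℝ) : ℝ :=
  ∑' i : (ℕ × ℕ) × ℕ × ℕ,
    if i.1.2 < 2 ^ i.1.1 ∧ i.2.2 < 2 ^ i.2.1 ∧
        ((2 : ℝ) ^ i.2.1)⁻¹ / ((2 : ℝ) ^ i.1.1)⁻¹ ≤ v q then
      (∫ w in unitSq, f w * haarFn i.1.1 i.1.2 w.1 * haarFn i.2.1 i.2.2 w.2) *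
        haarFn i.1.1 i.1.2 q.1 * haarFn i.2.1 i.2.2 q.2
    else 0

section FibreAverage

variable {Ω : Type*} [Fintype Ω]

/-- The average of `f` over the fibre of `π` through `x`. -/
noncomputable def fibAvg (π : Ω → ℕ) (f : Ω → ℝ) (x : Ω) : ℝ :=
  (∑ y with π y = π x, f y) / (Finset.card {y | π y = π x} : ℕ)

lemma fibre_card_pos (π : Ω → ℕ) (x : Ω) :
    (0 : ℝ) < (Finset.card {y | π y = π x} : ℕ) := by
  exact_mod_cast Finset.card_pos.2 ⟨x, by simp⟩

lemma fibAvg_factors (π : Ω → ℕ) (f : Ω → ℝ) : Function.FactorsThrough (fibAvg π f) π := by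
  intro x y h
  simp only [fibAvg, h]

lemma fibAvg_mul_left {π : Ω → ℕ} {g : Ω → ℝ} (hg : Function.FactorsThrough g π) (f : Ω → ℝ)
    (x : Ω) : fibAvg π (fun y => g y * f y) x = g x * fibAvg π f x := by
  rw [fibAvg, fibAvg, ← mul_div_assoc, Finset.mul_sum]
  congr 1
  refine Finset.sum_congr rfl fun y hy => ?_
  rw [hg (Finset.mem_filter.1 hy).2]

lemma fibAvg_const (π : Ω → ℕ) (c : ℝ) (x : Ω) : fibAvg π (fun _ => c) x = c := by
  have := fibre_card_pos π x
  rw [fibAvg, Finset.sum_const, nsmul_eq_mul]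
  field_simp

lemma fibAvg_eq_self {π : Ω → ℕ} {g : Ω → ℝ} (hg : Function.FactorsThrough g π) :
    fibAvg π g = g := by
  funext x
  have := fibAvg_mul_left hg (fun _ => 1) x
  simpa [fibAvg_const] using this

lemma fibAvg_sum {ι : Type*} (s : Finset ι) (π : Ω → ℕ) (f : ι → Ω → ℝ) (x : Ω) :
    fibAvg π (fun y => ∑ i ∈ s, f i y) x = ∑ i ∈ s, fibAvg π (f i) x := by
  simp only [fibAvg]
  rw [Finset.sum_comm, Finset.sum_div]

lemma fibAvg_mono (π : Ω → ℕ) {f g : Ω → ℝ} (h : ∀ x, f x ≤ g x) (x : Ω) :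
    fibAvg π f x ≤ fibAvg π g x := by
  unfold fibAvg
  gcongr with y
  exact h y

lemma fibAvg_nonneg (π : Ω → ℕ) {f : Ω → ℝ} (h : ∀ x, 0 ≤ f x) (x : Ω) : 0 ≤ fibAvg π f x :=
  div_nonneg (Finset.sum_nonneg fun y _ => h y) (Nat.cast_nonneg _)

lemma abs_fibAvg_le (π : Ω → ℕ) (f : Ω → ℝ) (x : Ω) :
    |fibAvg π f x| ≤ fibAvg π (fun y => |f y|) x := by
  unfold fibAvg
  rw [abs_div, Nat.abs_cast]
  gcongr
  exact Finset.abs_sum_le_sum_abs _ _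

lemma sum_mul_fibAvg {π : Ω → ℕ} {g : Ω → ℝ} (hg : Function.FactorsThrough g π) (f : Ω → ℝ) :
    ∑ x, g x * fibAvg π f x = ∑ x, g x * f x := by
  have h1 : ∀ x, g x * fibAvg π f x =
      ∑ y, if π y = π x then g x * f y / (Finset.card {z | π z = π x} : ℕ) else 0 := by
    intro x
    rw [fibAvg, ← mul_div_assoc, Finset.mul_sum, Finset.sum_div, Finset.sum_filter]
  simp_rw [h1]
  rw [Finset.sum_comm]
  refine Finset.sum_congr rfl fun y _ => ?_
  have h2 : ∀ x, (if π y = π x then g x * f y / (Finset.card {z | π z = π x} : ℕ) else 0) =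
      if π x = π y then g y * f y / (Finset.card {z | π z = π y} : ℕ) else 0 := by
    intro x
    by_cases h : π x = π y
    · rw [if_pos h.symm, if_pos h, hg h, h]
    · rw [if_neg (Ne.symm h), if_neg h]
  simp_rw [h2]
  rw [← Finset.sum_filter, Finset.sum_const, nsmul_eq_mul]
  have := fibre_card_pos π y
  field_simp

lemma sum_mul_fibAvg_sub {π : Ω → ℕ} {g : Ω → ℝ} (hg : Function.FactorsThrough g π) (f : Ω → ℝ) :
    ∑ x, g x * (f x - fibAvg π f x) = 0 := by
  simp only [mul_sub, Finset.sum_sub_distrib, sum_mul_fibAvg hg, sub_self]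

lemma fibAvg_fibAvg {π π' : Ω → ℕ} (h : Function.FactorsThrough π π') (f : Ω → ℝ) :
    fibAvg π (fibAvg π' f) = fibAvg π f := by
  funext x
  have hg : Function.FactorsThrough (fun y => if π y = π x then (1 : ℝ) else 0) π' := by
    intro a b hab
    simp only [h hab]
  have := sum_mul_fibAvg hg f
  simp only [ite_mul, one_mul, zero_mul, ← Finset.sum_filter] at this
  rw [fibAvg, this, fibAvg]

lemma sqrt_sum_sq_fibAvg_le {ι : Type*} (s : Finset ι) (π : Ω → ℕ) (F : ι → Ω → ℝ) (x : Ω) :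
    ∑ i ∈ s, fibAvg π (F i) x ^ 2 ≤ fibAvg π (fun y => √(∑ i ∈ s, F i y ^ 2)) x ^ 2 := by
  set A := ∑ i ∈ s, fibAvg π (F i) x ^ 2 with hA
  set B := fibAvg π (fun y => √(∑ i ∈ s, F i y ^ 2)) x with hB
  have hA0 : 0 ≤ A := Finset.sum_nonneg fun i _ => sq_nonneg _
  have hB0 : 0 ≤ B := fibAvg_nonneg _ (fun _ => Real.sqrt_nonneg _) _
  have key : A ≤ √A * B := by
    have e1 : A = fibAvg π (fun y => ∑ i ∈ s, fibAvg π (F i) x * F i y) x := by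
      rw [fibAvg_sum, hA]
      refine Finset.sum_congr rfl fun i _ => ?_
      rw [fibAvg_mul_left (g := fun _ => fibAvg π (F i) x) (fun _ _ _ => rfl), sq]
    have e2 : √A * B = fibAvg π (fun y => √A * √(∑ i ∈ s, F i y ^ 2)) x := by
      rw [fibAvg_mul_left (g := fun _ => √A) (fun _ _ _ => rfl)]
    rw [e2]
    nth_rw 1 [e1]
    exact fibAvg_mono _ (fun y => Real.sum_mul_le_sqrt_mul_sqrt _ _ _) x
  have h3 : √A * √A = A := Real.mul_self_sqrt hA0
  rcases hA0.eq_or_lt with h | h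
  · rw [← h]; positivity
  · have h4 : √A ≤ B := by
      have := Real.sqrt_pos.2 h
      nlinarith
    nlinarith [Real.sqrt_nonneg A]

/-- A filtration of a finite set by partitions into fibres, in which a fibre is
at most twice as large as each of its children. -/
structure IsDoublingFiltration (π : ℕ → Ω → ℕ) : Prop where
  factors : ∀ n, Function.FactorsThrough (π n) (π (n + 1))
  card_le : ∀ n x, Finset.card {y | π n y = π n x} ≤ 2 * Finset.card {y | π (n + 1) y = π (n + 1) x}

namespace IsDoublingFiltration

variable {π : ℕ → Ω → ℕ}

lemma factors_of_le (h : IsDoublingFiltration π) {m n : ℕ} (hmn : m ≤ n) :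
    Function.FactorsThrough (π m) (π n) := by
  induction n, hmn using Nat.le_induction with
  | base => exact fun _ _ h => h
  | succ n _ ih => exact fun a b hab => ih (h.factors n hab)

lemma factors_mono (h : IsDoublingFiltration π) {m n : ℕ} (hmn : m ≤ n) {κ : Type*} {g : Ω → κ}
    (hg : Function.FactorsThrough g (π m)) : Function.FactorsThrough g (π n) :=
  fun _ _ hab => hg (h.factors_of_le hmn hab)

lemma shift (h : IsDoublingFiltration π) (k : ℕ) : IsDoublingFiltration fun n => π (k + n) :=
  ⟨fun n => h.factors (k + n), fun n => h.card_le (k + n)⟩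

lemma fibAvg_succ_le (h : IsDoublingFiltration π) {f : Ω → ℝ} (hf : ∀ x, 0 ≤ f x) (n : ℕ) (x : Ω) :
    fibAvg (π (n + 1)) f x ≤ 2 * fibAvg (π n) f x := by
  unfold fibAvg
  have h1 := fibre_card_pos (π n) x
  have h2 := fibre_card_pos (π (n + 1)) x
  have h3 : ((Finset.card {y | π n y = π n x} : ℕ) : ℝ) ≤
      2 * (Finset.card {y | π (n + 1) y = π (n + 1) x} : ℕ) := by exact_mod_cast h.card_le n x
  have h4 : ∑ y with π (n + 1) y = π (n + 1) x, f y ≤ ∑ y with π n y = π n x, f y := by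
    refine Finset.sum_le_sum_of_subset_of_nonneg (fun y hy => ?_) fun y _ _ => hf y
    simp only [Finset.mem_filter, Finset.mem_univ, true_and] at hy ⊢
    exact h.factors n hy
  have h5 : 0 ≤ ∑ y with π (n + 1) y = π (n + 1) x, f y := Finset.sum_nonneg fun y _ => hf y
  rw [← mul_div_assoc, div_le_div_iff₀ h2 h1]
  nlinarith

lemma fibAvg_fibAvg_succ (h : IsDoublingFiltration π) (n : ℕ) (f : Ω → ℝ) :
    fibAvg (π n) (fibAvg (π (n + 1)) f) = fibAvg (π n) f :=
  _root_.fibAvg_fibAvg (h.factors n) f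

/-- Martingale differences are orthogonal to functions measurable with respect to the past. -/
lemma sum_mul_diff (h : IsDoublingFiltration π) {n : ℕ} {g : Ω → ℝ}
    (hg : Function.FactorsThrough g (π n)) (f : Ω → ℝ) :
    ∑ x, g x * (fibAvg (π (n + 1)) f x - fibAvg (π n) f x) = 0 := by
  have := sum_mul_fibAvg_sub hg (fibAvg (π (n + 1)) f)
  rwa [h.fibAvg_fibAvg_succ] at this

lemma sum_mul_diff_sq (h : IsDoublingFiltration π) {n : ℕ} {g : Ω → ℝ}
    (hg : Function.FactorsThrough g (π n)) (f : Ω → ℝ) :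
    ∑ x, g x * (fibAvg (π (n + 1)) f x - fibAvg (π n) f x) ^ 2 =
      ∑ x, g x * (fibAvg (π (n + 1)) f x ^ 2 - fibAvg (π n) f x ^ 2) := by
  have h1 : Function.FactorsThrough (fun x => 2 * g x * fibAvg (π n) f x) (π n) := by
    intro a b hab
    simp only [hg hab, fibAvg_factors (π n) f hab]
  have := h.sum_mul_diff h1 f
  rw [← sub_eq_zero, ← Finset.sum_sub_distrib, ← neg_eq_zero, ← Finset.sum_neg_distrib, ← this]
  refine Finset.sum_congr rfl fun x _ => ?_
  ring

lemma sum_mul_abs_diff_nonneg (h : IsDoublingFiltration π) {n : ℕ} {g : Ω → ℝ}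
    (hg : Function.FactorsThrough g (π n)) (hg0 : ∀ x, 0 ≤ g x) (f : Ω → ℝ) :
    0 ≤ ∑ x, g x * (|fibAvg (π (n + 1)) f x| - |fibAvg (π n) f x|) := by
  rw [← sum_mul_fibAvg_sub hg (fun x => |fibAvg (π (n + 1)) f x|)]
  refine Finset.sum_le_sum fun x _ => mul_le_mul_of_nonneg_left (sub_le_sub_left ?_ _) (hg0 x)
  rw [← h.fibAvg_fibAvg_succ]
  exact abs_fibAvg_le _ _ _

lemma partialSups_factors (h : IsDoublingFiltration π) {u : ℕ → Ω → ℝ}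
    (hu : ∀ n, Function.FactorsThrough (u n) (π n)) (n : ℕ) :
    Function.FactorsThrough (fun x => partialSups (fun k => u k x) n) (π n) := by
  intro a b hab
  induction n with
  | zero => simpa using hu 0 hab
  | succ n ih =>
    have := ih (h.factors n hab)
    simp only [partialSups_add_one] at this ⊢
    rw [this, hu (n + 1) hab]

end IsDoublingFiltration

end FibreAverage

section RpowInequalities

lemma mul_rpow_sub_one_mul_le {r c b z : ℝ} (hr : 1 < r) (hc : 0 < c) (hb : 0 ≤ b) (hz : 0 ≤ z) :
    c * (b ^ (r - 1) * z) ≤ b ^ r / 2 + (2 * c) ^ r * z ^ r := by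
  have hb1 : b ^ r = b ^ (r - 1) * b := by
    rw [← Real.rpow_add_one' hb (by linarith)]
    congr 1
    ring
  have hbr : 0 ≤ b ^ (r - 1) := Real.rpow_nonneg hb _
  rw [← Real.mul_rpow (by positivity) hz]
  rcases le_total (2 * c * z) b with h | h
  · have : 0 ≤ (2 * c * z) ^ r := by positivity
    nlinarith
  · have h1 : b ^ (r - 1) ≤ (2 * c * z) ^ (r - 1) := Real.rpow_le_rpow hb h (by linarith)
    have h2 : (2 * c * z) ^ r = (2 * c * z) ^ (r - 1) * (2 * c * z) := by
      rw [← Real.rpow_add_one' (by positivity) (by linarith)]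
      congr 1
      ring
    have h3 : 0 ≤ b ^ r / 2 := by positivity
    rw [h2]
    have hcz : 0 ≤ c * z := by positivity
    nlinarith [mul_le_mul_of_nonneg_right h1 hcz, mul_nonneg (hbr.trans h1) hcz]

lemma sum_rpow_le_of_absorb {α : Type*} {s : Finset α} {r c : ℝ} {B Z : α → ℝ} (hr : 1 < r)
    (hc : 0 < c) (hB : ∀ x ∈ s, 0 ≤ B x) (hZ : ∀ x ∈ s, 0 ≤ Z x)
    (h : ∑ x ∈ s, B x ^ r ≤ c * ∑ x ∈ s, B x ^ (r - 1) * Z x) :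
    ∑ x ∈ s, B x ^ r ≤ 2 * (2 * c) ^ r * ∑ x ∈ s, Z x ^ r := by
  have h1 : c * ∑ x ∈ s, B x ^ (r - 1) * Z x ≤
      (∑ x ∈ s, B x ^ r) / 2 + (2 * c) ^ r * ∑ x ∈ s, Z x ^ r := by
    rw [Finset.mul_sum, Finset.sum_div, Finset.mul_sum, ← Finset.sum_add_distrib]
    exact Finset.sum_le_sum fun x hx => mul_rpow_sub_one_mul_le hr hc (hB x hx) (hZ x hx)
  linarith

lemma rpow_sub_rpow_le_conj {p s t : ℝ} (hp : 1 < p) (hs : 0 ≤ s) (ht : 0 ≤ t) :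
    t ^ p - s ^ p ≤ p / (p - 1) * (t * (t ^ (p - 1) - s ^ (p - 1))) := by
  have hpq : p.HolderConjugate (p / (p - 1)) := Real.HolderConjugate.conjExponent hp
  have hy := Real.young_inequality_of_nonneg ht (Real.rpow_nonneg hs (p - 1)) hpq
  have hp1 : 0 < p - 1 := by linarith
  rw [← Real.rpow_mul hs, mul_div_cancel₀ _ hp1.ne'] at hy
  have ht1 : t ^ p = t * t ^ (p - 1) := by
    rw [mul_comm, ← Real.rpow_add_one' ht (by linarith)]
    congr 1
    ring
  have h1 := mul_le_mul_of_nonneg_left hy (by positivity : 0 ≤ p / (p - 1))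
  have e : p / (p - 1) * (t ^ p / p + s ^ p / (p / (p - 1))) = p / (p - 1) * t ^ p - t ^ p + s ^ p := by
    field_simp
    ring
  rw [e] at h1
  rw [mul_sub, mul_sub, ← ht1]
  linarith

lemma rpow_sub_rpow_le {r s t : ℝ} (hr : 1 ≤ r) (hs : 0 ≤ s) (hst : s ≤ t) :
    t ^ r - s ^ r ≤ r * (t ^ (r - 1) * (t - s)) := by
  rcases hst.eq_or_lt with rfl | hlt
  · simp
  have ht : 0 < t := hs.trans_lt hlt
  have h1 := one_add_mul_self_le_rpow_one_add (s := s / t - 1) (by have : 0 ≤ s / t := by positivity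
                                                                   linarith) hr
  rw [add_sub_cancel, Real.div_rpow hs ht.le, le_div_iff₀ (by positivity)] at h1
  have h2 : t ^ r = t ^ (r - 1) * t := by
    rw [← Real.rpow_add_one ht.ne']
    congr 1
    ring
  have h3 : (1 + r * (s / t - 1)) * t ^ r = t ^ r - r * (t ^ (r - 1) * (t - s)) := by
    rw [h2]
    field_simp
    ring
  linarith

lemma rpow_weight_step {p s t : ℝ} (hp : 1 < p) (hs : 0 ≤ s) (hst : s ≤ t) (hts : t ≤ 2 * s) :
    (s ^ (p - 2) - t ^ (p - 2)) * t ^ 2 ≤ 3 * (t ^ p - s ^ p) := by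
  rcases hs.eq_or_lt with rfl | hs0
  · have : t = 0 := by linarith
    simp [this]
  have ht : 0 < t := hs0.trans_le hst
  have e1 : s ^ p = s ^ (p - 2) * s ^ 2 := by
    rw [← Real.rpow_natCast, ← Real.rpow_add hs0]
    congr 1
    norm_num
  have e2 : t ^ p = t ^ (p - 2) * t ^ 2 := by
    rw [← Real.rpow_natCast, ← Real.rpow_add ht]
    congr 1
    norm_num
  have hsp : 0 < s ^ (p - 2) := by positivity
  have e3 : s ^ p * (t / s) ≤ t ^ p := by
    have h1 : t / s ≤ (t / s) ^ p := Real.self_le_rpow_of_one_le ((one_le_div hs0).2 hst) hp.le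
    rw [Real.div_rpow ht.le hs] at h1
    have := mul_le_mul_of_nonneg_left h1 (by positivity : 0 ≤ s ^ p)
    rwa [mul_div_cancel₀ _ (by positivity)] at this
  have e4 : s ^ (p - 2) * s * t ≤ t ^ p := by
    refine le_trans (le_of_eq ?_) e3
    rw [e1]
    field_simp
  have e5 : s ^ (p - 2) * t ^ 2 - s ^ (p - 2) * s ^ 2 ≤ 3 * (s ^ (p - 2) * s * t - s ^ (p - 2) * s ^ 2) := by
    have : t ^ 2 - s ^ 2 ≤ 3 * (s * t - s ^ 2) := by nlinarith
    nlinarith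
  have e6 : s ^ p ≤ t ^ p := Real.rpow_le_rpow hs hst (by linarith)
  rw [sub_mul, ← e2]
  rw [← e1] at e5
  linarith

lemma rpow_le_weighted {p a t : ℝ} (hp : 1 < p) (hp2 : p ≤ 2) (ha : 0 ≤ a) (ht : 0 ≤ t)
    (h0 : t = 0 → a = 0) : a ^ p ≤ t ^ (p - 2) * a ^ 2 + t ^ p := by
  rcases le_or_gt a t with h | h
  · have := Real.rpow_le_rpow ha h (by linarith : 0 ≤ p)
    have h2 : 0 ≤ t ^ (p - 2) * a ^ 2 := by positivity
    linarith
  · have ha0 : 0 < a := ht.trans_lt h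
    have ht0 : 0 < t := ht.lt_of_ne fun h => ha0.ne' (h0 h.symm)
    have e2 : a ^ p = a ^ (p - 2) * a ^ 2 := by
      rw [← Real.rpow_natCast, ← Real.rpow_add ha0]
      congr 1
      norm_num
    have h1 : a ^ (p - 2) ≤ t ^ (p - 2) := Real.rpow_le_rpow_of_nonpos ht0 h.le (by linarith)
    have h2 : 0 ≤ t ^ p := by positivity
    rw [e2]
    nlinarith [sq_nonneg a]

end RpowInequalities

section Maximal

variable {Ω : Type*} [Fintype Ω] {π : ℕ → Ω → ℕ}

/-- The maximal function `max_{k ≤ n} |E_k f|` of a filtration. -/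
noncomputable def maxAvg (π : ℕ → Ω → ℕ) (f : Ω → ℝ) (n : ℕ) (x : Ω) : ℝ :=
  partialSups (fun k => |fibAvg (π k) f x|) n

lemma maxAvg_succ (π : ℕ → Ω → ℕ) (f : Ω → ℝ) (n : ℕ) (x : Ω) :
    maxAvg π f (n + 1) x = max (maxAvg π f n x) |fibAvg (π (n + 1)) f x| :=
  partialSups_add_one _ _

lemma maxAvg_zero (π : ℕ → Ω → ℕ) (f : Ω → ℝ) (x : Ω) : maxAvg π f 0 x = |fibAvg (π 0) f x| := by
  simp [maxAvg]

lemma le_maxAvg (π : ℕ → Ω → ℕ) (f : Ω → ℝ) {k n : ℕ} (hkn : k ≤ n) (x : Ω) :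
    |fibAvg (π k) f x| ≤ maxAvg π f n x :=
  le_partialSups_of_le (fun k => |fibAvg (π k) f x|) hkn

lemma maxAvg_nonneg (π : ℕ → Ω → ℕ) (f : Ω → ℝ) (n : ℕ) (x : Ω) : 0 ≤ maxAvg π f n x :=
  (abs_nonneg _).trans (le_maxAvg π f (Nat.zero_le n) x)

lemma maxAvg_mono (π : ℕ → Ω → ℕ) (f : Ω → ℝ) {m n : ℕ} (h : m ≤ n) (x : Ω) :
    maxAvg π f m x ≤ maxAvg π f n x :=
  (partialSups _).monotone h

lemma maxAvg_le {f : Ω → ℝ} {n : ℕ} {x : Ω} {c : ℝ} (h : ∀ k ≤ n, |fibAvg (π k) f x| ≤ c) :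
    maxAvg π f n x ≤ c :=
  partialSups_le _ _ _ h

namespace IsDoublingFiltration

lemma maxAvg_factors (h : IsDoublingFiltration π) (f : Ω → ℝ) (n : ℕ) :
    Function.FactorsThrough (maxAvg π f n) (π n) :=
  h.partialSups_factors (u := fun k x => |fibAvg (π k) f x|)
    (fun n a b hab => by simp only [fibAvg_factors (π n) f hab]) n

lemma maxAvg_succ_le (h : IsDoublingFiltration π) {f : Ω → ℝ} (hf : ∀ x, 0 ≤ f x) (n : ℕ)
    (x : Ω) : maxAvg π f (n + 1) x ≤ 2 * maxAvg π f n x := by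
  have h1 := maxAvg_nonneg π f n x
  rw [maxAvg_succ]
  refine max_le (by linarith) ?_
  rw [abs_of_nonneg (fibAvg_nonneg _ hf x)]
  have h2 := h.fibAvg_succ_le hf n x
  have h3 := (le_abs_self _).trans (le_maxAvg π f (le_refl n) x)
  linarith

/-- Doob's maximal inequality. -/
lemma doob (h : IsDoublingFiltration π) {p : ℝ} (hp : 1 < p) {f : Ω → ℝ} (hf : ∀ x, 0 ≤ f x)
    (n : ℕ) :
    ∑ x, maxAvg π f n x ^ p ≤ 2 * (2 * (p / (p - 1))) ^ p * ∑ x, f x ^ p := by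
  have hp1 : 0 < p - 1 := by linarith
  have hc : 1 ≤ p / (p - 1) := by rw [one_le_div hp1]; linarith
  refine sum_rpow_le_of_absorb hp (by linarith) (fun x _ => maxAvg_nonneg _ _ _ _)
    (fun x _ => hf x) ?_
  induction n with
  | zero =>
    have h1 : ∀ x, maxAvg π f 0 x ^ p = maxAvg π f 0 x ^ (p - 1) * fibAvg (π 0) f x := by
      intro x
      have h0 := fibAvg_nonneg (π 0) hf x
      rw [maxAvg_zero, abs_of_nonneg h0, ← Real.rpow_add_one' h0 (by linarith)]
      congr 1
      ring
    simp_rw [h1]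
    rw [sum_mul_fibAvg (g := fun x => maxAvg π f 0 x ^ (p - 1))
      (fun a b hab => by simp only [h.maxAvg_factors f 0 hab])]
    refine le_mul_of_one_le_left (Finset.sum_nonneg fun x _ => mul_nonneg ?_ (hf x)) hc
    exact Real.rpow_nonneg (maxAvg_nonneg _ _ _ _) _
  | succ n ih =>
    have h1 : ∀ x, maxAvg π f (n + 1) x ^ p - maxAvg π f n x ^ p ≤ p / (p - 1) *
        ((maxAvg π f (n + 1) x ^ (p - 1) - maxAvg π f n x ^ (p - 1)) * fibAvg (π (n + 1)) f x) := by
      intro x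
      have h0 := fibAvg_nonneg (π (n + 1)) hf x
      rw [maxAvg_succ, abs_of_nonneg h0]
      rcases le_total (fibAvg (π (n + 1)) f x) (maxAvg π f n x) with hle | hle
      · simp [max_eq_left hle]
      · rw [max_eq_right hle, mul_comm (_ - _)]
        exact rpow_sub_rpow_le_conj hp (maxAvg_nonneg _ _ _ _) h0
    have h2 := Finset.sum_le_sum fun x (_ : x ∈ Finset.univ) => h1 x
    rw [← Finset.mul_sum, sum_mul_fibAvg
      (g := fun x => maxAvg π f (n + 1) x ^ (p - 1) - maxAvg π f n x ^ (p - 1))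
      (fun a b hab => by
        simp only [h.maxAvg_factors f (n + 1) hab, h.maxAvg_factors f n (h.factors n hab)])] at h2
    simp only [sub_mul, Finset.sum_sub_distrib, mul_sub] at h2
    linarith

/-- A weighted `L²` maximal inequality, for weights which decrease along the filtration. -/
lemma sum_weight_mul_maxAvg_sq_le (h : IsDoublingFiltration π) {w : ℕ → Ω → ℝ}
    (hw : ∀ n, Function.FactorsThrough (w n) (π n)) (hw0 : ∀ n x, 0 ≤ w n x)
    (hanti : ∀ n x, w (n + 1) x ≤ w n x) (f : Ω → ℝ) (N : ℕ) :
    ∑ x, w N x * maxAvg π f N x ^ 2 ≤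
      4 * ∑ x, (w 0 x * fibAvg (π 0) f x ^ 2 + ∑ n ∈ Finset.range N,
        w n x * (fibAvg (π (n + 1)) f x ^ 2 - fibAvg (π n) f x ^ 2)) := by
  set u : ℕ → Ω → ℝ := fun n x => |fibAvg (π n) f x| with hu
  set R : ℕ → Ω → ℝ := fun n x => 2 * (maxAvg π f n x - u n x) ^ 2 + 2 * u n x ^ 2 with hR
  have hR0 : ∀ n x, 0 ≤ R n x := fun n x => by positivity
  have hsq : ∀ n x, u n x ^ 2 = fibAvg (π n) f x ^ 2 := fun n x => sq_abs _
  have key : ∑ x, w N x * R N x ≤ 4 * ∑ x, (w 0 x * fibAvg (π 0) f x ^ 2 +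
      ∑ n ∈ Finset.range N, w n x * (fibAvg (π (n + 1)) f x ^ 2 - fibAvg (π n) f x ^ 2)) := by
    induction N with
    | zero =>
      rw [Finset.mul_sum]
      refine Finset.sum_le_sum fun x _ => ?_
      have h1 : maxAvg π f 0 x = u 0 x := maxAvg_zero π f x
      simp only [hR, h1, Finset.range_zero, Finset.sum_empty, ← hsq]
      nlinarith [mul_nonneg (hw0 0 x) (sq_nonneg (u 0 x))]
    | succ n ih =>
      have hstep : ∀ x, w (n + 1) x * R (n + 1) x ≤ w n x * R n x +
          4 * (w n x * (fibAvg (π (n + 1)) f x ^ 2 - fibAvg (π n) f x ^ 2)) -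
          4 * (w n x * maxAvg π f n x * (u (n + 1) x - u n x)) := by
        intro x
        refine (mul_le_mul_of_nonneg_right (hanti n x) (hR0 (n + 1) x)).trans ?_
        have : R (n + 1) x ≤ R n x + 4 * (u (n + 1) x ^ 2 - u n x ^ 2) -
            4 * (maxAvg π f n x * (u (n + 1) x - u n x)) := by
          simp only [hR, maxAvg_succ]
          rcases le_total (u (n + 1) x) (maxAvg π f n x) with hle | hle
          · rw [max_eq_left hle]
            nlinarith
          · rw [max_eq_right hle]
            nlinarith [sq_nonneg (u (n + 1) x - maxAvg π f n x)]
        rw [← hsq, ← hsq]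
        nlinarith [mul_le_mul_of_nonneg_left this (hw0 n x)]
      have h1 := Finset.sum_le_sum fun x (_ : x ∈ Finset.univ) => hstep x
      have h2 : 0 ≤ ∑ x, w n x * maxAvg π f n x * (u (n + 1) x - u n x) :=
        h.sum_mul_abs_diff_nonneg (g := fun x => w n x * maxAvg π f n x)
          (fun a b hab => by simp only [hw n hab, h.maxAvg_factors f n hab])
          (fun x => mul_nonneg (hw0 n x) (maxAvg_nonneg _ _ _ _)) f
      simp only [Finset.sum_sub_distrib, Finset.sum_add_distrib, ← Finset.mul_sum] at h1
      simp only [Finset.sum_range_succ, Finset.sum_add_distrib, mul_add] at ih ⊢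
      linarith
  refine le_trans (Finset.sum_le_sum fun x _ => mul_le_mul_of_nonneg_left ?_ (hw0 N x)) key
  simp only [hR]
  nlinarith [sq_nonneg (maxAvg π f N x - 2 * u N x)]

lemma sum_mul_maxAvg_sq_le (h : IsDoublingFiltration π) {w : Ω → ℝ}
    (hw : Function.FactorsThrough w (π 0)) (hw0 : ∀ x, 0 ≤ w x) (f : Ω → ℝ) {N : ℕ}
    (hf : Function.FactorsThrough f (π N)) :
    ∑ x, w x * maxAvg π f N x ^ 2 ≤ 4 * ∑ x, w x * f x ^ 2 := by
  refine (h.sum_weight_mul_maxAvg_sq_le (w := fun _ => w)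
    (fun n => h.factors_mono (Nat.zero_le n) hw) (fun _ => hw0) (fun _ _ => le_rfl) f N).trans_eq ?_
  congr 1
  refine Finset.sum_congr rfl fun x _ => ?_
  rw [← Finset.mul_sum, Finset.sum_range_sub (fun n => fibAvg (π n) f x ^ 2),
    fibAvg_eq_self hf]
  ring

end IsDoublingFiltration

end Maximal

section Weights

lemma rpow_sub_two_anti {p s t : ℝ} (hp2 : p ≤ 2) (hs : 0 ≤ s) (hst : s ≤ t) (hts : t ≤ 2 * s) :
    t ^ (p - 2) ≤ s ^ (p - 2) := by
  rcases hs.eq_or_lt with rfl | hs0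
  · have : t = 0 := by linarith
    rw [this]
  · exact Real.rpow_le_rpow_of_nonpos hs0 hst (by linarith)

lemma weighted_increments_le {p : ℝ} (hp : 1 < p) (hp2 : p ≤ 2) {t a : ℕ → ℝ} (ht : ∀ n, 0 ≤ t n)
    (hmono : ∀ n, t n ≤ t (n + 1)) (hdouble : ∀ n, t (n + 1) ≤ 2 * t n)
    (hat : ∀ n, a n ≤ t n ^ 2) (N : ℕ) :
    t 0 ^ (p - 2) * a 0 + ∑ n ∈ Finset.range N, t n ^ (p - 2) * (a (n + 1) - a n) ≤
      4 * t N ^ p := by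
  have key : t 0 ^ (p - 2) * a 0 + ∑ n ∈ Finset.range N, t n ^ (p - 2) * (a (n + 1) - a n) ≤
      t N ^ (p - 2) * a N + 3 * t N ^ p := by
    induction N with
    | zero =>
      have : 0 ≤ t 0 ^ p := Real.rpow_nonneg (ht 0) _
      simp only [Finset.range_zero, Finset.sum_empty]
      linarith
    | succ n ih =>
      rw [Finset.sum_range_succ]
      have h1 := rpow_weight_step hp (ht n) (hmono n) (hdouble n)
      have h2 := rpow_sub_two_anti hp2 (ht n) (hmono n) (hdouble n)
      nlinarith [mul_le_mul_of_nonneg_left (hat (n + 1)) (sub_nonneg.2 h2)]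
  have h3 : t N ^ (p - 2) * a N ≤ t N ^ p := by
    refine (mul_le_mul_of_nonneg_left (hat N) (Real.rpow_nonneg (ht N) _)).trans ?_
    rw [← Real.rpow_natCast, ← Real.rpow_add' (ht N) (by push_cast; linarith)]
    norm_num
  linarith

lemma rpow_le_sum_increments {r : ℝ} (hr : 1 < r) {b : ℕ → ℝ} (h0 : b 0 = 0)
    (hmono : ∀ n, b n ≤ b (n + 1)) (N : ℕ) :
    b N ^ r ≤ r * ∑ n ∈ Finset.range N, (b (n + 1) ^ (r - 1) - b n ^ (r - 1)) * (b N - b n) := by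
  have hb : ∀ n, 0 ≤ b n := fun n => h0 ▸ monotone_nat_of_le_succ hmono (Nat.zero_le n)
  have key : ∀ (L : ℝ) (n : ℕ), r * (b n ^ (r - 1) * (L - b n)) + b n ^ r ≤
      r * ∑ k ∈ Finset.range n, (b (k + 1) ^ (r - 1) - b k ^ (r - 1)) * (L - b k) := by
    intro L n
    induction n with
    | zero => simp [h0, Real.zero_rpow (by linarith : r ≠ 0), Real.zero_rpow (by linarith : r - 1 ≠ 0)]
    | succ n ih =>
      rw [Finset.sum_range_succ]
      have := rpow_sub_rpow_le hr.le (hb n) (hmono n)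
      nlinarith
  simpa using key (b N) N

lemma sqrt_rpow_eq {p a : ℝ} (ha : 0 ≤ a) : √a ^ p = a ^ (p / 2) := by
  rw [Real.sqrt_eq_rpow, ← Real.rpow_mul ha]
  congr 1
  ring

end Weights

namespace IsDoublingFiltration

variable {Ω : Type*} [Fintype Ω] {π : ℕ → Ω → ℕ}

/-- Garsia's lemma: an increasing process whose conditional remainders are dominated by `Z` is
bounded by `Z` in `L^r`. -/
lemma garsia (h : IsDoublingFiltration π) {r : ℝ} (hr : 1 < r) {B : ℕ → Ω → ℝ} {Z : Ω → ℝ} {N : ℕ}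
    (hZ : ∀ x, 0 ≤ Z x) (hB0 : ∀ x, B 0 x = 0) (hmono : ∀ n x, B n x ≤ B (n + 1) x)
    (hB : ∀ n, Function.FactorsThrough (B (n + 1)) (π n))
    (hrem : ∀ n ≤ N, ∀ w : Ω → ℝ, Function.FactorsThrough w (π n) → (∀ x, 0 ≤ w x) →
      ∑ x, w x * (B (N + 1) x - B n x) ≤ ∑ x, w x * Z x) :
    ∑ x, B (N + 1) x ^ r ≤ 2 * (2 * r) ^ r * ∑ x, Z x ^ r := by
  have hnn : ∀ n x, 0 ≤ B n x := fun n x =>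
    hB0 x ▸ monotone_nat_of_le_succ (fun k => hmono k x) (Nat.zero_le n)
  refine sum_rpow_le_of_absorb hr (by linarith) (fun x _ => hnn _ x) (fun x _ => hZ x) ?_
  set w : ℕ → Ω → ℝ := fun n x => B (n + 1) x ^ (r - 1) - B n x ^ (r - 1) with hw
  have hwfac : ∀ n, Function.FactorsThrough (w n) (π n) := by
    intro n a b hab
    simp only [hw, hB n hab]
    congr 2
    cases n with
    | zero => rw [hB0, hB0]
    | succ n => exact hB n (h.factors n hab)
  have hw0 : ∀ n x, 0 ≤ w n x := fun n x =>
    sub_nonneg.2 (Real.rpow_le_rpow (hnn n x) (hmono n x) (by linarith))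
  calc ∑ x, B (N + 1) x ^ r
      ≤ ∑ x, r * ∑ n ∈ Finset.range (N + 1), w n x * (B (N + 1) x - B n x) :=
        Finset.sum_le_sum fun x _ =>
          rpow_le_sum_increments hr (b := fun n => B n x) (hB0 x) (fun n => hmono n x) (N + 1)
    _ = r * ∑ n ∈ Finset.range (N + 1), ∑ x, w n x * (B (N + 1) x - B n x) := by
        rw [← Finset.mul_sum, Finset.sum_comm]
    _ ≤ r * ∑ n ∈ Finset.range (N + 1), ∑ x, w n x * Z x := by
        refine mul_le_mul_of_nonneg_left (Finset.sum_le_sum fun n hn => ?_) (by linarith)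
        exact hrem n (by have := Finset.mem_range.1 hn; omega) _ (hwfac n) (hw0 n)
    _ = r * ∑ x, B (N + 1) x ^ (r - 1) * Z x := by
        rw [Finset.sum_comm]
        congr 1
        refine Finset.sum_congr rfl fun x _ => ?_
        rw [← Finset.sum_mul, Finset.sum_range_sub (fun n => B n x ^ (r - 1)), hB0,
          Real.zero_rpow (by linarith), sub_zero]

lemma abs_fibAvg_le_maxAvg_sqrt {ι : Type*} {s : Finset ι} (F : ι → Ω → ℝ) {i : ι} (hi : i ∈ s)
    {n N : ℕ} (hn : n ≤ N) (x : Ω) :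
    |fibAvg (π n) (F i) x| ≤ maxAvg π (fun x => √(∑ i ∈ s, F i x ^ 2)) N x := by
  refine le_trans ?_ ((le_abs_self _).trans (le_maxAvg π _ hn x))
  refine abs_le_of_sq_le_sq ?_ (fibAvg_nonneg _ (fun _ => Real.sqrt_nonneg _) _)
  exact (Finset.single_le_sum (f := fun i => fibAvg (π n) (F i) x ^ 2)
    (fun _ _ => sq_nonneg _) hi).trans (sqrt_sum_sq_fibAvg_le s (π n) F x)

lemma sum_sq_fibAvg_le {ι : Type*} (s : Finset ι) (F : ι → Ω → ℝ) (n : ℕ) (x : Ω) :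
    ∑ i ∈ s, fibAvg (π n) (F i) x ^ 2 ≤ maxAvg π (fun x => √(∑ i ∈ s, F i x ^ 2)) n x ^ 2 := by
  refine (sqrt_sum_sq_fibAvg_le s (π n) F x).trans ?_
  have h0 := fibAvg_nonneg (π n) (f := fun x => √(∑ i ∈ s, F i x ^ 2))
    (fun _ => Real.sqrt_nonneg _) x
  exact pow_le_pow_left₀ h0 ((le_abs_self _).trans (le_maxAvg π _ le_rfl x)) 2

/-- The weight `(max_{k ≤ n} E_k X)^{p-2}` attached to a nonnegative function `X`. -/
lemma weight_factors (h : IsDoublingFiltration π) (X : Ω → ℝ) (p : ℝ) (n : ℕ) :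
    Function.FactorsThrough (fun x => maxAvg π X n x ^ (p - 2)) (π n) :=
  fun a b hab => by simp only [h.maxAvg_factors X n hab]

lemma weight_anti (h : IsDoublingFiltration π) {X : Ω → ℝ} (hX : ∀ x, 0 ≤ X x) {p : ℝ}
    (hp2 : p ≤ 2) (n : ℕ) (x : Ω) : maxAvg π X (n + 1) x ^ (p - 2) ≤ maxAvg π X n x ^ (p - 2) :=
  rpow_sub_two_anti hp2 (maxAvg_nonneg _ _ _ _) (maxAvg_mono _ _ (Nat.le_succ n) x)
    (h.maxAvg_succ_le hX n x)

lemma vector_maximal_of_le_two (h : IsDoublingFiltration π) {p : ℝ} (hp : 1 < p) (hp2 : p ≤ 2)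
    {ι : Type*} (s : Finset ι) (F : ι → Ω → ℝ) (N : ℕ) :
    ∑ x, √(∑ i ∈ s, maxAvg π (F i) N x ^ 2) ^ p ≤
      17 * (2 * (2 * (p / (p - 1))) ^ p) * ∑ x, √(∑ i ∈ s, F i x ^ 2) ^ p := by
  set X : Ω → ℝ := fun x => √(∑ i ∈ s, F i x ^ 2) with hX
  have hX0 : ∀ x, 0 ≤ X x := fun _ => Real.sqrt_nonneg _
  have h1 : ∀ x, √(∑ i ∈ s, maxAvg π (F i) N x ^ 2) ^ p ≤
      maxAvg π X N x ^ (p - 2) * (∑ i ∈ s, maxAvg π (F i) N x ^ 2) + maxAvg π X N x ^ p := by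
    intro x
    have hS : 0 ≤ ∑ i ∈ s, maxAvg π (F i) N x ^ 2 := Finset.sum_nonneg fun _ _ => sq_nonneg _
    have := rpow_le_weighted hp hp2 (Real.sqrt_nonneg (∑ i ∈ s, maxAvg π (F i) N x ^ 2))
      (maxAvg_nonneg π X N x) ?_
    · rwa [Real.sq_sqrt hS] at this
    · intro h0
      rw [Finset.sum_eq_zero, Real.sqrt_zero]
      intro i hi
      have : maxAvg π (F i) N x ≤ 0 :=
        h0 ▸ maxAvg_le fun k hk => abs_fibAvg_le_maxAvg_sqrt F hi hk x
      rw [le_antisymm this (maxAvg_nonneg _ _ _ _)]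
      norm_num
  have h2 : ∀ i, ∑ x, maxAvg π X N x ^ (p - 2) * maxAvg π (F i) N x ^ 2 ≤ _ := fun i =>
    h.sum_weight_mul_maxAvg_sq_le (w := fun n x => maxAvg π X n x ^ (p - 2))
      (h.weight_factors X p) (fun n x => Real.rpow_nonneg (maxAvg_nonneg _ _ _ _) _)
      (h.weight_anti hX0 hp2) (F i) N
  have h3 := Finset.sum_le_sum fun i (_ : i ∈ s) => h2 i
  rw [Finset.sum_comm, ← Finset.mul_sum, Finset.sum_comm (s := s)] at h3
  have h4 : ∀ x, ∑ i ∈ s, (maxAvg π X 0 x ^ (p - 2) * fibAvg (π 0) (F i) x ^ 2 +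
      ∑ n ∈ Finset.range N, maxAvg π X n x ^ (p - 2) *
        (fibAvg (π (n + 1)) (F i) x ^ 2 - fibAvg (π n) (F i) x ^ 2)) ≤ 4 * maxAvg π X N x ^ p := by
    intro x
    rw [Finset.sum_add_distrib, Finset.sum_comm]
    simp only [← Finset.mul_sum, Finset.sum_sub_distrib]
    exact weighted_increments_le hp hp2 (t := fun n => maxAvg π X n x)
      (a := fun n => ∑ i ∈ s, fibAvg (π n) (F i) x ^ 2)
      (fun n => maxAvg_nonneg _ _ _ _) (fun n => maxAvg_mono _ _ (Nat.le_succ n) x)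
      (fun n => h.maxAvg_succ_le hX0 n x) (fun n => sum_sq_fibAvg_le s F n x) N
  have h5 := Finset.sum_le_sum fun x (_ : x ∈ Finset.univ) => h4 x
  have h6 := Finset.sum_le_sum fun x (_ : x ∈ Finset.univ) => h1 x
  have h7 := h.doob hp hX0 N
  simp only [Finset.sum_add_distrib, Finset.mul_sum (s := s)] at h6
  rw [← Finset.mul_sum] at h5
  linarith

lemma vector_maximal_of_two_lt (h : IsDoublingFiltration π) {p : ℝ} (hp : 2 < p)
    {ι : Type*} (s : Finset ι) (F : ι → Ω → ℝ) {N : ℕ}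
    (hF : ∀ i ∈ s, Function.FactorsThrough (F i) (π N)) :
    ∑ x, √(∑ i ∈ s, maxAvg π (F i) N x ^ 2) ^ p ≤
      2 * (2 * (p / 2)) ^ (p / 2) * 4 ^ (p / 2) * ∑ x, √(∑ i ∈ s, F i x ^ 2) ^ p := by
  set B : ℕ → Ω → ℝ := fun n x => if n = 0 then 0 else ∑ i ∈ s, maxAvg π (F i) (n - 1) x ^ 2 with hB
  have hBs : ∀ n x, B (n + 1) x = ∑ i ∈ s, maxAvg π (F i) n x ^ 2 := fun n x => by simp [hB]
  have hrem : ∀ n ≤ N, ∀ x, B (N + 1) x - B n x ≤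
      ∑ i ∈ s, maxAvg (fun m => π (n + m)) (F i) (N - n) x ^ 2 := by
    intro n hn x
    rw [hBs]
    cases n with
    | zero => simp [hB]
    | succ n =>
      rw [hBs, ← Finset.sum_sub_distrib]
      refine Finset.sum_le_sum fun i _ => ?_
      set K := maxAvg (fun m => π (n + 1 + m)) (F i) (N - (n + 1)) x with hK
      have h1 : maxAvg π (F i) N x ≤ max (maxAvg π (F i) n x) K := by
        refine maxAvg_le fun k hk => ?_
        rcases le_or_gt k n with hkn | hkn
        · exact le_max_of_le_left (le_maxAvg π (F i) hkn x)
        · refine le_max_of_le_right ?_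
          have := le_maxAvg (fun m => π (n + 1 + m)) (F i)
            (by omega : k - (n + 1) ≤ N - (n + 1)) x
          simpa [Nat.add_sub_cancel' (by omega : n + 1 ≤ k)] using this
      have h0 := maxAvg_nonneg π (F i) N x
      rcases le_total (maxAvg π (F i) n x) K with hle | hle
      · rw [max_eq_right hle] at h1
        nlinarith [sq_nonneg (maxAvg π (F i) n x)]
      · rw [max_eq_left hle] at h1
        nlinarith [sq_nonneg K]
  have hS : ∀ x, 0 ≤ ∑ i ∈ s, F i x ^ 2 := fun x => Finset.sum_nonneg fun _ _ => sq_nonneg _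
  have hM : ∀ x, 0 ≤ ∑ i ∈ s, maxAvg π (F i) N x ^ 2 :=
    fun x => Finset.sum_nonneg fun _ _ => sq_nonneg _
  have key := h.garsia (r := p / 2) (by linarith) (B := B) (Z := fun x => 4 * ∑ i ∈ s, F i x ^ 2)
    (N := N) (fun x => by have := hS x; positivity) (fun x => by simp [hB]) ?_ ?_ ?_
  · simp_rw [hBs] at key
    simp_rw [sqrt_rpow_eq (hM _), sqrt_rpow_eq (hS _)]
    refine key.trans_eq ?_
    rw [mul_assoc _ (4 ^ (p / 2)), Finset.mul_sum (a := (4 : ℝ) ^ (p / 2))]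
    congr 1
    exact Finset.sum_congr rfl fun x _ => Real.mul_rpow (by norm_num) (hS x)
  · intro n x
    rw [hBs]
    cases n with
    | zero =>
      simp only [hB, if_true]
      exact Finset.sum_nonneg fun _ _ => sq_nonneg _
    | succ n =>
      rw [hBs]
      gcongr with i
      · exact maxAvg_nonneg _ _ _ _
      · exact maxAvg_mono _ _ (Nat.le_succ n) x
  · intro n a b hab
    rw [hBs, hBs]
    exact Finset.sum_congr rfl fun i _ => by rw [h.maxAvg_factors (F i) n hab]
  · intro n hn w hw hw0
    calc ∑ x, w x * (B (N + 1) x - B n x)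
        ≤ ∑ x, w x * ∑ i ∈ s, maxAvg (fun m => π (n + m)) (F i) (N - n) x ^ 2 :=
          Finset.sum_le_sum fun x _ => mul_le_mul_of_nonneg_left (hrem n hn x) (hw0 x)
      _ = ∑ i ∈ s, ∑ x, w x * maxAvg (fun m => π (n + m)) (F i) (N - n) x ^ 2 := by
          simp only [Finset.mul_sum]
          exact Finset.sum_comm
      _ ≤ ∑ i ∈ s, 4 * ∑ x, w x * F i x ^ 2 := by
          refine Finset.sum_le_sum fun i hi => (h.shift n).sum_mul_maxAvg_sq_le hw hw0 (F i) ?_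
          simpa only [Nat.add_sub_cancel' hn] using hF i hi
      _ = ∑ x, w x * (4 * ∑ i ∈ s, F i x ^ 2) := by
          simp only [Finset.mul_sum]
          rw [Finset.sum_comm]
          exact Finset.sum_congr rfl fun x _ => Finset.sum_congr rfl fun i _ => by ring

lemma abs_fibAvg_le_maxAvg_abs (f : Ω → ℝ) {n N : ℕ} (hn : n ≤ N) (x : Ω) :
    |fibAvg (π n) f x| ≤ maxAvg π (fun x => |f x|) N x :=
  (abs_fibAvg_le _ _ _).trans ((le_abs_self _).trans (le_maxAvg π _ hn x))

lemma square_function_of_le_two (h : IsDoublingFiltration π) {p : ℝ} (hp : 1 < p) (hp2 : p ≤ 2)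
    (f : Ω → ℝ) (N : ℕ) :
    ∑ x, √(∑ n ∈ Finset.range N, (fibAvg (π (n + 1)) f x - fibAvg (π n) f x) ^ 2) ^ p ≤
      5 * (2 * (2 * (p / (p - 1))) ^ p) * ∑ x, |f x| ^ p := by
  set X : Ω → ℝ := fun x => |f x| with hX
  have hX0 : ∀ x, 0 ≤ X x := fun _ => abs_nonneg _
  set D : ℕ → Ω → ℝ := fun n x => fibAvg (π (n + 1)) f x - fibAvg (π n) f x with hD
  have hw0 : ∀ n x, 0 ≤ maxAvg π X n x ^ (p - 2) :=
    fun n x => Real.rpow_nonneg (maxAvg_nonneg _ _ _ _) _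
  have h1 : ∀ x, √(∑ n ∈ Finset.range N, D n x ^ 2) ^ p ≤
      maxAvg π X N x ^ (p - 2) * (∑ n ∈ Finset.range N, D n x ^ 2) + maxAvg π X N x ^ p := by
    intro x
    have hS : 0 ≤ ∑ n ∈ Finset.range N, D n x ^ 2 := Finset.sum_nonneg fun _ _ => sq_nonneg _
    have := rpow_le_weighted hp hp2 (Real.sqrt_nonneg (∑ n ∈ Finset.range N, D n x ^ 2))
      (maxAvg_nonneg π X N x) ?_
    · rwa [Real.sq_sqrt hS] at this
    · intro h0
      rw [Finset.sum_eq_zero, Real.sqrt_zero]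
      intro n hn
      have hn := Finset.mem_range.1 hn
      have e1 := abs_nonpos_iff.1 (h0 ▸ abs_fibAvg_le_maxAvg_abs (π := π) f hn x)
      have e2 := abs_nonpos_iff.1 (h0 ▸ abs_fibAvg_le_maxAvg_abs (π := π) f hn.le x)
      simp only [hD, Nat.succ_eq_add_one] at e1 e2 ⊢
      rw [e1, e2]
      norm_num
  have h2 : ∀ x, maxAvg π X N x ^ (p - 2) * (∑ n ∈ Finset.range N, D n x ^ 2) ≤
      ∑ n ∈ Finset.range N, maxAvg π X n x ^ (p - 2) * D n x ^ 2 := by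
    intro x
    rw [Finset.mul_sum]
    refine Finset.sum_le_sum fun n hn => mul_le_mul_of_nonneg_right ?_ (sq_nonneg _)
    exact antitone_nat_of_succ_le (f := fun n => maxAvg π X n x ^ (p - 2))
      (fun n => h.weight_anti hX0 hp2 n x) (Finset.mem_range.1 hn).le
  have h3 : ∑ x, ∑ n ∈ Finset.range N, maxAvg π X n x ^ (p - 2) * D n x ^ 2 =
      ∑ x, ∑ n ∈ Finset.range N, maxAvg π X n x ^ (p - 2) *
        (fibAvg (π (n + 1)) f x ^ 2 - fibAvg (π n) f x ^ 2) := by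
    rw [Finset.sum_comm, Finset.sum_comm (s := Finset.univ)]
    exact Finset.sum_congr rfl fun n _ => h.sum_mul_diff_sq (h.weight_factors X p n) f
  have h4 : ∀ x, ∑ n ∈ Finset.range N, maxAvg π X n x ^ (p - 2) *
      (fibAvg (π (n + 1)) f x ^ 2 - fibAvg (π n) f x ^ 2) ≤ 4 * maxAvg π X N x ^ p := by
    intro x
    have := weighted_increments_le hp hp2 (t := fun n => maxAvg π X n x)
      (a := fun n => fibAvg (π n) f x ^ 2)
      (fun n => maxAvg_nonneg _ _ _ _) (fun n => maxAvg_mono _ _ (Nat.le_succ n) x)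
      (fun n => h.maxAvg_succ_le hX0 n x)
      (fun n => sq_le_sq' (neg_le_of_abs_le (abs_fibAvg_le_maxAvg_abs f le_rfl x))
        (le_of_abs_le (abs_fibAvg_le_maxAvg_abs f le_rfl x))) N
    have h0 : 0 ≤ maxAvg π X 0 x ^ (p - 2) * fibAvg (π 0) f x ^ 2 :=
      mul_nonneg (hw0 0 x) (sq_nonneg _)
    linarith
  have h5 := Finset.sum_le_sum fun x (_ : x ∈ Finset.univ) => h4 x
  have h6 := Finset.sum_le_sum fun x (_ : x ∈ Finset.univ) => (h1 x).trans
    (add_le_add_left (h2 x) (maxAvg π X N x ^ p))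
  have h7 := h.doob hp hX0 N
  simp only [Finset.sum_add_distrib] at h6
  rw [← Finset.mul_sum] at h5
  linarith

lemma square_function_of_two_lt (h : IsDoublingFiltration π) {p : ℝ} (hp : 2 < p)
    (f : Ω → ℝ) (N : ℕ) :
    ∑ x, √(∑ n ∈ Finset.range N, (fibAvg (π (n + 1)) f x - fibAvg (π n) f x) ^ 2) ^ p ≤
      2 * (2 * (p / 2)) ^ (p / 2) * 5 ^ (p / 2) * (2 * (2 * (p / (p - 1))) ^ p) *
        ∑ x, |f x| ^ p := by
  set D : ℕ → Ω → ℝ := fun n x => fibAvg (π (n + 1)) f x - fibAvg (π n) f x with hD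
  set X : Ω → ℝ := fun x => maxAvg π (fun x => |f x|) N x with hX
  have hX0 : ∀ x, 0 ≤ X x := fun x => maxAvg_nonneg _ _ _ _
  have hE : ∀ n ≤ N, ∀ x, fibAvg (π n) f x ^ 2 ≤ X x ^ 2 := fun n hn x =>
    sq_le_sq' (neg_le_of_abs_le (abs_fibAvg_le_maxAvg_abs f hn x))
      (le_of_abs_le (abs_fibAvg_le_maxAvg_abs f hn x))
  have hDX : ∀ n < N, ∀ x, D n x ^ 2 ≤ 4 * X x ^ 2 := by
    intro n hn x
    have h1 := hE n hn.le x
    have h2 := hE (n + 1) hn x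
    simp only [hD]
    nlinarith [sq_nonneg (fibAvg (π (n + 1)) f x + fibAvg (π n) f x)]
  set B : ℕ → Ω → ℝ := fun n x => ∑ k ∈ Finset.range (n - 1), D k x ^ 2 with hB
  have hrem : ∀ n ≤ N, ∀ x, B (N + 1) x - B n x ≤
      4 * X x ^ 2 + ∑ k ∈ Finset.Ico n N, D k x ^ 2 := by
    intro n hn x
    cases n with
    | zero =>
      simp only [hB, Nat.add_sub_cancel, Nat.zero_sub, Finset.range_zero, Finset.sum_empty,
        sub_zero, ← Finset.range_eq_Ico]
      nlinarith [sq_nonneg (X x)]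
    | succ n =>
      have h1 := hDX n hn x
      simp only [hB, Nat.add_sub_cancel]
      rw [← Finset.sum_Ico_eq_sub _ (by omega : n ≤ N), Finset.sum_eq_sum_Ico_succ_bot hn]
      linarith
  have hS : ∀ x, 0 ≤ ∑ n ∈ Finset.range N, D n x ^ 2 :=
    fun x => Finset.sum_nonneg fun _ _ => sq_nonneg _
  have key := h.garsia (r := p / 2) (by linarith) (B := B) (Z := fun x => 5 * X x ^ 2)
    (N := N) (fun x => by positivity) (fun x => by simp [hB]) ?_ ?_ ?_
  · have h1 : ∀ x, (5 * X x ^ 2) ^ (p / 2) = 5 ^ (p / 2) * X x ^ p := by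
      intro x
      rw [Real.mul_rpow (by norm_num) (sq_nonneg _), ← sqrt_rpow_eq (sq_nonneg _),
        Real.sqrt_sq (hX0 x)]
    rw [Finset.sum_congr rfl fun x _ => h1 x, ← Finset.mul_sum] at key
    refine (Finset.sum_congr rfl fun x _ => sqrt_rpow_eq (hS x)).trans_le (key.trans ?_)
    rw [← mul_assoc, mul_assoc (_ * _) (2 * _)]
    exact mul_le_mul_of_nonneg_left (h.doob (by linarith) (fun x => abs_nonneg (f x)) N)
      (by positivity)
  · intro n x
    exact Finset.sum_le_sum_of_subset_of_nonneg (Finset.range_mono (by omega))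
      fun _ _ _ => sq_nonneg _
  · intro n a b hab
    refine Finset.sum_congr rfl fun k hk => ?_
    have hk : k + 1 ≤ n := Finset.mem_range.1 hk
    simp only [hD, fibAvg_factors _ f (h.factors_of_le hk hab),
      fibAvg_factors _ f (h.factors_of_le (Nat.le_of_succ_le hk) hab)]
  · intro n hn w hw hw0
    have h1 : ∑ x, w x * ∑ k ∈ Finset.Ico n N, D k x ^ 2 =
        ∑ x, w x * (fibAvg (π N) f x ^ 2 - fibAvg (π n) f x ^ 2) := by
      have h2 : ∀ k ∈ Finset.Ico n N, ∑ x, w x * D k x ^ 2 = ∑ x, w x *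
          (fibAvg (π (k + 1)) f x ^ 2 - fibAvg (π k) f x ^ 2) := fun k hk =>
        h.sum_mul_diff_sq (h.factors_mono (Finset.mem_Ico.1 hk).1 hw) f
      simp only [Finset.mul_sum]
      rw [Finset.sum_comm, Finset.sum_congr rfl h2, Finset.sum_comm]
      refine Finset.sum_congr rfl fun x _ => ?_
      rw [← Finset.mul_sum, Finset.sum_Ico_sub (fun k => fibAvg (π k) f x ^ 2) hn]
    calc ∑ x, w x * (B (N + 1) x - B n x)
        ≤ ∑ x, w x * (4 * X x ^ 2 + ∑ k ∈ Finset.Ico n N, D k x ^ 2) :=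
          Finset.sum_le_sum fun x _ => mul_le_mul_of_nonneg_left (hrem n hn x) (hw0 x)
      _ = ∑ x, w x * (4 * X x ^ 2 + (fibAvg (π N) f x ^ 2 - fibAvg (π n) f x ^ 2)) := by
          simp only [mul_add, Finset.sum_add_distrib, h1]
      _ ≤ ∑ x, w x * (5 * X x ^ 2) := by
          refine Finset.sum_le_sum fun x _ => mul_le_mul_of_nonneg_left ?_ (hw0 x)
          have := hE N le_rfl x
          nlinarith [sq_nonneg (fibAvg (π n) f x)]

end IsDoublingFiltration

section Bounds

lemma exists_vector_maximal {p : ℝ} (hp : 1 < p) : ∃ C : ℝ, 0 < C ∧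
    ∀ (Ω : Type) [Fintype Ω] (π : ℕ → Ω → ℕ), IsDoublingFiltration π →
      ∀ (N : ℕ) (s : Finset ℕ) (F : ℕ → Ω → ℝ),
        (∀ i ∈ s, Function.FactorsThrough (F i) (π N)) →
        ∑ x, √(∑ i ∈ s, maxAvg π (F i) N x ^ 2) ^ p ≤ C * ∑ x, √(∑ i ∈ s, F i x ^ 2) ^ p := by
  have hp1 : 0 < p - 1 := by linarith
  rcases le_or_gt p 2 with hp2 | hp2
  · exact ⟨_, by positivity, fun Ω _ π h N s F _ => h.vector_maximal_of_le_two hp hp2 s F N⟩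
  · exact ⟨_, by positivity, fun Ω _ π h N s F hF => h.vector_maximal_of_two_lt hp2 s F hF⟩

lemma exists_square_function {p : ℝ} (hp : 1 < p) : ∃ C : ℝ, 0 < C ∧
    ∀ (Ω : Type) [Fintype Ω] (π : ℕ → Ω → ℕ), IsDoublingFiltration π →
      ∀ (N : ℕ) (f : Ω → ℝ),
        ∑ x, √(∑ n ∈ Finset.range N, (fibAvg (π (n + 1)) f x - fibAvg (π n) f x) ^ 2) ^ p ≤
          C * ∑ x, |f x| ^ p := by
  have hp1 : 0 < p - 1 := by linarith
  rcases le_or_gt p 2 with hp2 | hp2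
  · exact ⟨_, by positivity, fun Ω _ π h N f => h.square_function_of_le_two hp hp2 f N⟩
  · exact ⟨_, by positivity, fun Ω _ π h N f => h.square_function_of_two_lt hp2 f N⟩

lemma exists_reverse_square_function {p : ℝ} (hp : 1 < p) : ∃ C : ℝ, 0 < C ∧
    ∀ (Ω : Type) [Fintype Ω] (π : ℕ → Ω → ℕ), IsDoublingFiltration π →
      ∀ (N : ℕ) (F : ℕ → Ω → ℝ),
        (∀ n < N, Function.FactorsThrough (F n) (π (n + 1))) →
        (∀ n < N, ∀ x, fibAvg (π n) (F n) x = 0) →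
        ∑ x, |∑ n ∈ Finset.range N, F n x| ^ p ≤
          C * ∑ x, √(∑ n ∈ Finset.range N, F n x ^ 2) ^ p := by
  have hpq : p.HolderConjugate (p / (p - 1)) := Real.HolderConjugate.conjExponent hp
  have hp1 : 0 < p - 1 := by linarith
  set q := p / (p - 1) with hq
  have hq1 : 1 < q := hpq.symm.lt
  obtain ⟨K₀, hK₀, hS⟩ := exists_square_function hq1
  set K : ℝ := (2 * K₀) ^ q⁻¹ with hK
  have hKpos : 0 < K := by positivity
  have hKq : K ^ q = 2 * K₀ := by
    rw [hK, ← Real.rpow_mul (by positivity), inv_mul_cancel₀ (by positivity), Real.rpow_one]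
  refine ⟨2 * K ^ p, by positivity, fun Ω _ π h N F hF hF0 => ?_⟩
  set G : Ω → ℝ := fun x => ∑ n ∈ Finset.range N, F n x with hG
  set g : Ω → ℝ := fun x => G x * |G x| ^ (p - 2) with hg
  set a : Ω → ℝ := fun x => √(∑ n ∈ Finset.range N, F n x ^ 2) with ha
  set S : Ω → ℝ := fun x =>
    √(∑ n ∈ Finset.range N, (fibAvg (π (n + 1)) g x - fibAvg (π n) g x) ^ 2) with hSdef
  have hGg : ∀ x, |G x| ^ p = G x * g x := by
    intro x
    rcases eq_or_ne (G x) 0 with h0 | h0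
    · simp [h0, Real.zero_rpow (by linarith : p ≠ 0)]
    · simp only [hg]
      rw [← mul_assoc, ← abs_mul_abs_self (G x), ← sq, ← Real.rpow_natCast, ← Real.rpow_add
        (abs_pos.2 h0)]
      congr 1
      push_cast
      ring
  have hgq : ∀ x, |g x| ^ q = |G x| ^ p := by
    intro x
    rcases eq_or_ne (G x) 0 with h0 | h0
    · simp [hg, h0, Real.zero_rpow (by linarith : p ≠ 0), Real.zero_rpow (by linarith : q ≠ 0)]
    · have hpos := abs_pos.2 h0
      have h1 : |g x| = |G x| ^ (p - 1) := by
        simp only [hg]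
        rw [abs_mul, abs_of_nonneg (Real.rpow_nonneg (abs_nonneg (G x)) (p - 2)), mul_comm,
          ← Real.rpow_add_one hpos.ne']
        congr 1
        ring
      rw [h1, ← Real.rpow_mul hpos.le, hq, mul_div_cancel₀ _ hp1.ne']
  have hdual : ∀ n < N, ∑ x, F n x * g x =
      ∑ x, F n x * (fibAvg (π (n + 1)) g x - fibAvg (π n) g x) := by
    intro n hn
    have e1 := sum_mul_fibAvg (hF n hn) g
    have e2 := sum_mul_fibAvg (fibAvg_factors (π n) g) (F n)
    simp only [hF0 n hn, mul_zero, Finset.sum_const_zero] at e2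
    simp only [mul_sub, Finset.sum_sub_distrib, e1, mul_comm (F n _) (fibAvg (π n) g _), ← e2,
      sub_zero]
  have h1 : ∑ x, |G x| ^ p ≤ ∑ x, a x * S x := by
    calc ∑ x, |G x| ^ p = ∑ n ∈ Finset.range N, ∑ x, F n x * g x := by
          rw [Finset.sum_comm]
          refine Finset.sum_congr rfl fun x _ => ?_
          rw [hGg, ← Finset.sum_mul]
      _ = ∑ x, ∑ n ∈ Finset.range N, F n x * (fibAvg (π (n + 1)) g x - fibAvg (π n) g x) := by
          rw [Finset.sum_congr rfl fun n hn => hdual n (Finset.mem_range.1 hn), Finset.sum_comm]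
      _ ≤ ∑ x, a x * S x := Finset.sum_le_sum fun x _ => Real.sum_mul_le_sqrt_mul_sqrt _ _ _
  have h2 : ∀ x, a x * S x ≤ K ^ p * a x ^ p + (2 * K₀)⁻¹ * S x ^ q := by
    intro x
    have ha0 : 0 ≤ a x := Real.sqrt_nonneg _
    have hS0 : 0 ≤ S x := Real.sqrt_nonneg _
    have hy := Real.young_inequality_of_nonneg (mul_nonneg hKpos.le ha0)
      (div_nonneg hS0 hKpos.le) hpq
    rw [Real.mul_rpow hKpos.le ha0, Real.div_rpow hS0 hKpos.le, hKq] at hy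
    have e1 : K * a x * (S x / K) = a x * S x := by field_simp
    have e2 : K ^ p * a x ^ p / p ≤ K ^ p * a x ^ p := div_le_self (by positivity) hp.le
    have e3 : S x ^ q / (2 * K₀) / q ≤ S x ^ q / (2 * K₀) := div_le_self (by positivity) hq1.le
    rw [e1] at hy
    rw [inv_mul_eq_div]
    linarith
  have h3 := Finset.sum_le_sum fun x (_ : x ∈ Finset.univ) => h2 x
  have h4 := hS Ω π h N g
  simp_rw [hgq] at h4
  rw [Finset.sum_add_distrib, ← Finset.mul_sum, ← Finset.mul_sum] at h3
  have h5 : (2 * K₀)⁻¹ * ∑ x, S x ^ q ≤ (∑ x, |G x| ^ p) / 2 := by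
    rw [inv_mul_le_iff₀ (by positivity)]
    linarith
  linarith

/-- Bound for sums of martingale differences in the second variable which are dominated by
maximal functions, in the first variable, of the martingale differences of `f`. -/
lemma exists_biparameter_bound {p : ℝ} (hp : 1 < p) : ∃ C : ℝ, 0 < C ∧
    ∀ (Ω : Type) [Fintype Ω] (π : ℕ → Ω → ℕ), IsDoublingFiltration π →
      ∀ (N : ℕ) (_ : Function.Injective (π N)) (f : Ω → Ω → ℝ) (F : ℕ → Ω → Ω → ℝ),
        (∀ n < N, ∀ x, Function.FactorsThrough (F n x) (π (n + 1))) →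
        (∀ n < N, ∀ x y, fibAvg (π n) (F n x) y = 0) →
        (∀ n < N, ∀ x y, |F n x y| ≤
          maxAvg π (fun x' => fibAvg (π (n + 1)) (f x') y - fibAvg (π n) (f x') y) N x) →
        ∑ x, ∑ y, |∑ n ∈ Finset.range N, F n x y| ^ p ≤ C * ∑ x, ∑ y, |f x y| ^ p := by
  obtain ⟨A, hA, hA'⟩ := exists_reverse_square_function hp
  obtain ⟨B, hB, hB'⟩ := exists_vector_maximal hp
  obtain ⟨D, hD, hD'⟩ := exists_square_function hp
  refine ⟨A * (B * D), by positivity, fun Ω _ π h N hinj f F hF hF0 hle => ?_⟩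
  set d : ℕ → Ω → Ω → ℝ := fun n y x => fibAvg (π (n + 1)) (f x) y - fibAvg (π n) (f x) y with hd
  calc ∑ x, ∑ y, |∑ n ∈ Finset.range N, F n x y| ^ p
      ≤ ∑ x, A * ∑ y, √(∑ n ∈ Finset.range N, F n x y ^ 2) ^ p :=
        Finset.sum_le_sum fun x _ => hA' Ω π h N (fun n => F n x) (fun n hn => hF n hn x)
          (fun n hn => hF0 n hn x)
    _ ≤ ∑ x, A * ∑ y, √(∑ n ∈ Finset.range N, maxAvg π (d n y) N x ^ 2) ^ p := by
        refine Finset.sum_le_sum fun x _ => mul_le_mul_of_nonneg_left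
          (Finset.sum_le_sum fun y _ => Real.rpow_le_rpow (Real.sqrt_nonneg _)
            (Real.sqrt_le_sqrt (Finset.sum_le_sum fun n hn => ?_)) (by linarith)) hA.le
        have := hle n (Finset.mem_range.1 hn) x y
        exact sq_le_sq' (neg_le_of_abs_le this) (le_of_abs_le this)
    _ = A * ∑ y, ∑ x, √(∑ n ∈ Finset.range N, maxAvg π (d n y) N x ^ 2) ^ p := by
        rw [← Finset.mul_sum, Finset.sum_comm]
    _ ≤ A * ∑ y, B * ∑ x, √(∑ n ∈ Finset.range N, d n y x ^ 2) ^ p :=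
        mul_le_mul_of_nonneg_left (Finset.sum_le_sum fun y _ =>
          hB' Ω π h N _ (fun n => d n y) fun _ _ a b hab => by rw [hinj hab]) hA.le
    _ = A * (B * ∑ x, ∑ y, √(∑ n ∈ Finset.range N, d n y x ^ 2) ^ p) := by
        rw [← Finset.mul_sum, Finset.sum_comm]
    _ ≤ A * (B * ∑ x, D * ∑ y, |f x y| ^ p) :=
        mul_le_mul_of_nonneg_left (mul_le_mul_of_nonneg_left
          (Finset.sum_le_sum fun x _ => hD' Ω π h N (f x)) hB.le) hA.le
    _ = A * (B * D) * ∑ x, ∑ y, |f x y| ^ p := by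
        rw [← Finset.mul_sum]
        ring

end Bounds

section DiscreteHaar

/-- The index of the dyadic interval of length `2^{-n}` containing the `a`-th dyadic interval of
length `2^{-N}`. -/
def dyadicBlock (N n : ℕ) (a : Fin (2 ^ N)) : ℕ := (a : ℕ) / 2 ^ (N - n)

lemma dyadicBlock_eq_succ_div_two {N n : ℕ} (hn : n < N) (a : Fin (2 ^ N)) :
    dyadicBlock N n a = dyadicBlock N (n + 1) a / 2 := by
  rw [dyadicBlock, dyadicBlock, Nat.div_div_eq_div_mul, ← pow_succ]
  congr 2
  omega

lemma dyadicBlock_injective (N : ℕ) : Function.Injective (dyadicBlock N N) := by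
  intro a b hab
  simpa [dyadicBlock, Fin.ext_iff] using hab

lemma card_dyadicBlock {N n m : ℕ} (hn : n ≤ N) (hm : m < 2 ^ n) :
    Finset.card {a : Fin (2 ^ N) | dyadicBlock N n a = m} = 2 ^ (N - n) := by
  have hs : 0 < 2 ^ (N - n) := by positivity
  have hN : 2 ^ N = 2 ^ n * 2 ^ (N - n) := by rw [← pow_add, Nat.add_sub_cancel' hn]
  have h1 : Finset.map Fin.valEmbedding {a : Fin (2 ^ N) | dyadicBlock N n a = m} =
      Finset.Ico (m * 2 ^ (N - n)) ((m + 1) * 2 ^ (N - n)) := by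
    ext x
    simp only [Finset.mem_map, Finset.mem_filter, Finset.mem_univ, true_and,
      Fin.valEmbedding_apply, Finset.mem_Ico]
    simp only [dyadicBlock]
    constructor
    · rintro ⟨a, rfl, rfl⟩
      exact ⟨Nat.div_mul_le_self _ _, Nat.lt_mul_of_div_lt (Nat.lt_succ_self _) hs⟩
    · rintro ⟨h1, h2⟩
      have hx : x < 2 ^ N := by
        rw [hN]
        exact h2.trans_le (Nat.mul_le_mul_right _ hm)
      refine ⟨⟨x, hx⟩, le_antisymm (α := ℕ) ?_ ?_, rfl⟩
      · exact Nat.lt_succ_iff.1 ((Nat.div_lt_iff_lt_mul hs).2 h2)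
      · exact (Nat.le_div_iff_mul_le hs).2 h1
  rw [← Finset.card_map Fin.valEmbedding, h1, Nat.card_Ico, ← Nat.sub_mul, Nat.add_sub_cancel_left,
    one_mul]

lemma dyadicBlock_lt {N n : ℕ} (hn : n ≤ N) (a : Fin (2 ^ N)) : dyadicBlock N n a < 2 ^ n := by
  rw [dyadicBlock, Nat.div_lt_iff_lt_mul (by positivity), ← pow_add, Nat.add_sub_cancel' hn]
  exact a.2

lemma isDoublingFiltration_dyadicBlock (N : ℕ) : IsDoublingFiltration (dyadicBlock N) where
  factors n a b hab := by
    rcases lt_or_ge n N with hn | hn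
    · rw [dyadicBlock_eq_succ_div_two hn, hab, ← dyadicBlock_eq_succ_div_two hn]
    · simpa only [dyadicBlock, Nat.sub_eq_zero_of_le hn,
        Nat.sub_eq_zero_of_le (hn.trans (Nat.le_succ n))] using hab
  card_le n a := by
    rcases lt_or_ge n N with hn | hn
    · rw [card_dyadicBlock hn.le (dyadicBlock_lt hn.le a), card_dyadicBlock hn (dyadicBlock_lt hn a),
        ← pow_succ']
      exact Nat.pow_le_pow_right (by norm_num) (by omega)
    · simp only [dyadicBlock, Nat.sub_eq_zero_of_le hn,
        Nat.sub_eq_zero_of_le (hn.trans (Nat.le_succ n))]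
      omega

/-- The values of the Haar function `haarFn n m` on the dyadic intervals of length `2^{-N}`. -/
noncomputable def haarVal (N n m : ℕ) (a : Fin (2 ^ N)) : ℝ :=
  (2 : ℝ) ^ ((n : ℝ) / 2) * ((if dyadicBlock N (n + 1) a = 2 * m then 1 else 0) -
    (if dyadicBlock N (n + 1) a = 2 * m + 1 then 1 else 0))

lemma haarVal_factors (N n m : ℕ) : Function.FactorsThrough (haarVal N n m)
    (dyadicBlock N (n + 1)) := by
  intro a b hab
  simp only [haarVal, hab]

lemma sum_haarVal {N n m : ℕ} (hn : n < N) (hm : m < 2 ^ n) : ∑ a, haarVal N n m a = 0 := by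
  have h2 : 2 ^ (n + 1) = 2 * 2 ^ n := by ring
  simp only [haarVal, ← Finset.mul_sum, Finset.sum_sub_distrib, Finset.sum_boole]
  rw [card_dyadicBlock hn (by omega), card_dyadicBlock hn (by omega), sub_self, mul_zero]

lemma haarVal_eq_zero {N n m : ℕ} (hn : n < N) {a : Fin (2 ^ N)} (ha : dyadicBlock N n a ≠ m) :
    haarVal N n m a = 0 := by
  rw [dyadicBlock_eq_succ_div_two hn] at ha
  rw [haarVal, if_neg (by omega), if_neg (by omega), sub_zero, mul_zero]

lemma fibAvg_haarVal_of_le {N n m k : ℕ} (hn : n < N) (hm : m < 2 ^ n) (hk : k ≤ n) :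
    fibAvg (dyadicBlock N k) (haarVal N n m) = fun _ => 0 := by
  have hfil := isDoublingFiltration_dyadicBlock N
  have h1 : fibAvg (dyadicBlock N n) (haarVal N n m) = fun _ => 0 := by
    funext a
    rw [fibAvg, div_eq_zero_iff]
    left
    by_cases ha : dyadicBlock N n a = m
    · rw [Finset.sum_filter_of_ne, sum_haarVal hn hm]
      intro b _ hb
      rw [ha]
      by_contra hne
      exact hb (haarVal_eq_zero hn hne)
    · refine Finset.sum_eq_zero fun b hb => haarVal_eq_zero hn ?_
      rwa [(Finset.mem_filter.1 hb).2]
  rw [← fibAvg_fibAvg (hfil.factors_of_le hk), h1]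
  funext a
  exact fibAvg_const _ 0 a

lemma fibAvg_haarVal_of_lt {N n m k : ℕ} (hk : n < k) :
    fibAvg (dyadicBlock N k) (haarVal N n m) = haarVal N n m :=
  fibAvg_eq_self ((isDoublingFiltration_dyadicBlock N).factors_mono hk (haarVal_factors N n m))

lemma sum_haarVal_mul_haarVal {N n m n' m' : ℕ} (hn : n < N) (hm : m < 2 ^ n) (hn' : n' < N)
    (hm' : m' < 2 ^ n') :
    ∑ a, haarVal N n m a * haarVal N n' m' a = if n = n' ∧ m = m' then 2 ^ N else 0 := by
  have key : ∀ {n m n' m' : ℕ}, n' < N → m' < 2 ^ n' → n < n' →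
      ∑ a, haarVal N n m a * haarVal N n' m' a = 0 := by
    intro n m n' m' hn' hm' hlt
    rw [← sum_mul_fibAvg ((isDoublingFiltration_dyadicBlock N).factors_mono hlt
      (haarVal_factors N n m)), fibAvg_haarVal_of_le hn' hm' le_rfl]
    simp
  rcases lt_trichotomy n n' with hlt | rfl | hlt
  · rw [key hn' hm' hlt, if_neg (by omega)]
  · by_cases hmm : m = m'
    · subst hmm
      rw [if_pos ⟨rfl, rfl⟩]
      have h1 : ∀ a, haarVal N n m a * haarVal N n m a = 2 ^ n *
          ((if dyadicBlock N (n + 1) a = 2 * m then 1 else 0) +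
          (if dyadicBlock N (n + 1) a = 2 * m + 1 then 1 else 0)) := by
        intro a
        have h2 : (2 : ℝ) ^ ((n : ℝ) / 2) * (2 : ℝ) ^ ((n : ℝ) / 2) = 2 ^ n := by
          rw [← Real.rpow_add (by norm_num), add_halves, Real.rpow_natCast]
        rw [haarVal, mul_mul_mul_comm, h2]
        congr 1
        by_cases e1 : dyadicBlock N (n + 1) a = 2 * m
        · rw [if_pos e1, if_neg (by omega)]
          norm_num
        · rw [if_neg e1]
          split_ifs <;> norm_num
      have h3 : 2 ^ (n + 1) = 2 * 2 ^ n := by ring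
      simp only [h1, ← Finset.mul_sum, Finset.sum_add_distrib, Finset.sum_boole]
      rw [card_dyadicBlock hn (by omega), card_dyadicBlock hn (by omega)]
      push_cast
      rw [← two_mul, ← pow_succ', ← pow_add]
      congr 1
      omega
    · rw [if_neg (by tauto)]
      refine Finset.sum_eq_zero fun a _ => ?_
      by_cases ha : dyadicBlock N n a = m
      · rw [haarVal_eq_zero hn' (m := m') (ha ▸ hmm), mul_zero]
      · rw [haarVal_eq_zero hn ha, zero_mul]
  · simp_rw [mul_comm (haarVal N n m _)]
    rw [key hn hm hlt, if_neg (by omega)]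

/-- The discretized estimate, where `κ` encodes the direction `v = 2^{-κ}`. -/
lemma exists_discrete_bound {p : ℝ} (hp : 1 < p) : ∃ C : ℝ, 0 < C ∧
    ∀ (N : ℕ) (s : Finset ((ℕ × ℕ) × ℕ × ℕ)) (c : (ℕ × ℕ) × ℕ × ℕ → ℝ)
      (κ : Fin (2 ^ N) → Fin (2 ^ N) → ℕ),
      (∀ i ∈ s, (i.1.1 < N ∧ i.1.2 < 2 ^ i.1.1) ∧ (i.2.1 < N ∧ i.2.2 < 2 ^ i.2.1)) →
      (∀ n < N, ∀ a b b', dyadicBlock N n b = dyadicBlock N n b' → κ a b ≤ n → κ a b' = κ a b) →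
      ∑ a, ∑ b, |∑ i ∈ s, if i.1.1 + κ a b ≤ i.2.1 then
        c i * haarVal N i.1.1 i.1.2 a * haarVal N i.2.1 i.2.2 b else 0| ^ p ≤
      C * ∑ a, ∑ b, |∑ i ∈ s, c i * haarVal N i.1.1 i.1.2 a * haarVal N i.2.1 i.2.2 b| ^ p := by
  obtain ⟨C, hC, hbound⟩ := exists_biparameter_bound hp
  refine ⟨C, hC, fun N s c κ hs hκ => ?_⟩
  have hfil := isDoublingFiltration_dyadicBlock N
  set f : Fin (2 ^ N) → Fin (2 ^ N) → ℝ := fun a b =>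
    ∑ i ∈ s, c i * haarVal N i.1.1 i.1.2 a * haarVal N i.2.1 i.2.2 b with hf
  set F : ℕ → Fin (2 ^ N) → Fin (2 ^ N) → ℝ := fun n a b => ∑ i ∈ s with i.2.1 = n,
    (if i.1.1 + κ a b ≤ n then c i * haarVal N i.1.1 i.1.2 a else 0) *
      haarVal N i.2.1 i.2.2 b with hF
  have hcoef : ∀ n < N, ∀ (i : (ℕ × ℕ) × ℕ × ℕ) a, Function.FactorsThrough
      (fun b => if i.1.1 + κ a b ≤ n then c i * haarVal N i.1.1 i.1.2 a else 0)
      (dyadicBlock N n) := by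
    intro n hn i a b b' hbb
    have h1 := hκ n hn a b b' hbb
    have h2 := hκ n hn a b' b hbb.symm
    have : (i.1.1 + κ a b ≤ n) ↔ (i.1.1 + κ a b' ≤ n) := by
      constructor <;> intro h
      · rwa [h1 (by omega)]
      · rwa [h2 (by omega)]
    simp only [this]
  have hdiff : ∀ n < N, ∀ a b, fibAvg (dyadicBlock N (n + 1)) (f a) b -
      fibAvg (dyadicBlock N n) (f a) b = ∑ i ∈ s with i.2.1 = n,
        c i * haarVal N i.1.1 i.1.2 a * haarVal N i.2.1 i.2.2 b := by
    intro n hn a b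
    simp only [hf]
    rw [fibAvg_sum, fibAvg_sum, ← Finset.sum_sub_distrib, Finset.sum_filter]
    refine Finset.sum_congr rfl fun i hi => ?_
    have hi := hs i hi
    rw [fibAvg_mul_left (g := fun _ => c i * haarVal N i.1.1 i.1.2 a) (fun _ _ _ => rfl),
      fibAvg_mul_left (g := fun _ => c i * haarVal N i.1.1 i.1.2 a) (fun _ _ _ => rfl)]
    rcases lt_trichotomy i.2.1 n with hlt | heq | hlt
    · rw [fibAvg_haarVal_of_lt hlt, fibAvg_haarVal_of_lt (by omega), if_neg (by omega), sub_self]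
    · rw [fibAvg_haarVal_of_lt (by omega), fibAvg_haarVal_of_le hi.2.1 hi.2.2 (by omega),
        if_pos heq]
      ring
    · rw [fibAvg_haarVal_of_le hi.2.1 hi.2.2 hlt, fibAvg_haarVal_of_le hi.2.1 hi.2.2 hlt.le,
        if_neg (by omega)]
      ring
  have hsum : ∀ a b, ∑ n ∈ Finset.range N, F n a b = ∑ i ∈ s, if i.1.1 + κ a b ≤ i.2.1 then
      c i * haarVal N i.1.1 i.1.2 a * haarVal N i.2.1 i.2.2 b else 0 := by
    intro a b
    rw [← Finset.sum_fiberwise_of_maps_to (g := fun i => i.2.1) (t := Finset.range N)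
      fun i hi => Finset.mem_range.2 (hs i hi).2.1]
    refine Finset.sum_congr rfl fun n _ => Finset.sum_congr rfl fun i hi => ?_
    rw [(Finset.mem_filter.1 hi).2, ite_mul, zero_mul]
  simp_rw [← hsum]
  refine hbound _ _ hfil N (dyadicBlock_injective N) f F ?_ ?_ ?_
  · intro n hn a b b' hbb
    refine Finset.sum_congr rfl fun i hi => ?_
    have h1 := hcoef n hn i a (hfil.factors n hbb)
    have h2 := haarVal_factors N i.2.1 i.2.2 (show dyadicBlock N (i.2.1 + 1) b =
      dyadicBlock N (i.2.1 + 1) b' by rw [(Finset.mem_filter.1 hi).2, hbb])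
    simp only at h1
    rw [h1, h2]
  · intro n hn a b
    simp only [hF]
    rw [fibAvg_sum]
    refine Finset.sum_eq_zero fun i hi => ?_
    obtain ⟨his, hin⟩ := Finset.mem_filter.1 hi
    have := hs i his
    rw [fibAvg_mul_left (hcoef n hn i a), fibAvg_haarVal_of_le this.2.1 this.2.2 (by omega),
      mul_zero]
  · intro n hn a b
    simp only [hdiff n hn]
    by_cases hle : κ a b ≤ n
    · refine le_trans (le_of_eq ?_) (le_maxAvg _ _ (by omega : n - κ a b + 1 ≤ N) a)
      congr 1
      rw [fibAvg_sum]
      refine Finset.sum_congr rfl fun i hi => ?_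
      have hi := hs i (Finset.mem_filter.1 hi).1
      have h1 : (fun a' => c i * haarVal N i.1.1 i.1.2 a' * haarVal N i.2.1 i.2.2 b) =
          fun a' => (c i * haarVal N i.2.1 i.2.2 b) * haarVal N i.1.1 i.1.2 a' := by
        funext a'
        ring
      rw [h1, fibAvg_mul_left (g := fun _ => c i * haarVal N i.2.1 i.2.2 b) (fun _ _ _ => rfl)]
      by_cases hc : i.1.1 + κ a b ≤ n
      · rw [if_pos hc, fibAvg_haarVal_of_lt (by omega)]
        ring
      · rw [if_neg hc, fibAvg_haarVal_of_le hi.1.1 hi.1.2 (by omega)]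
        ring
    · rw [hF]
      simp only
      rw [Finset.sum_eq_zero, abs_zero]
      · exact maxAvg_nonneg _ _ _ _
      · intro i _
        rw [if_neg (by omega), zero_mul]

end DiscreteHaar

section DyadicCells

lemma dyadicI_index_unique {n m m' : ℕ} {x : ℝ} (h : x ∈ dyadicI n m) (h' : x ∈ dyadicI n m') :
    m = m' := by
  have h2 : (0 : ℝ) < 2 ^ n := by positivity
  simp only [dyadicI, Set.mem_Ioc, div_lt_iff₀ h2, le_div_iff₀ h2] at h h'
  have h3 : (m : ℝ) < m' + 1 := by linarith
  have h4 : (m' : ℝ) < m + 1 := by linarith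
  norm_cast at h3 h4
  omega

lemma dyadicI_subset {N n : ℕ} (hn : n ≤ N) (a : ℕ) :
    dyadicI N a ⊆ dyadicI n (a / 2 ^ (N - n)) := by
  have hN : (2 : ℝ) ^ N = 2 ^ n * 2 ^ (N - n) := by rw [← pow_add, Nat.add_sub_cancel' hn]
  have h1 : ((a / 2 ^ (N - n) : ℕ) : ℝ) * 2 ^ (N - n) ≤ a := by
    exact_mod_cast Nat.div_mul_le_self _ _
  have h2 : (a : ℝ) + 1 ≤ ((a / 2 ^ (N - n) : ℕ) + 1) * 2 ^ (N - n) := by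
    have := Nat.lt_mul_of_div_lt (Nat.lt_succ_self (a / 2 ^ (N - n)))
      (show 0 < 2 ^ (N - n) by positivity)
    exact_mod_cast this
  apply Set.Ioc_subset_Ioc
  · rw [hN, div_le_div_iff₀ (by positivity) (by positivity)]
    have : (0 : ℝ) < 2 ^ n := by positivity
    nlinarith
  · rw [hN, div_le_div_iff₀ (by positivity) (by positivity)]
    have : (0 : ℝ) < 2 ^ n := by positivity
    nlinarith

lemma mem_dyadicI_iff {N n m : ℕ} (hn : n ≤ N) {a : Fin (2 ^ N)} {x : ℝ} (hx : x ∈ dyadicI N a) :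
    x ∈ dyadicI n m ↔ dyadicBlock N n a = m := by
  have h := dyadicI_subset hn a hx
  refine ⟨fun h' => dyadicI_index_unique h h', ?_⟩
  rintro rfl
  exact h

lemma haarFn_eq_haarVal {N n : ℕ} (hn : n < N) (m : ℕ) {a : Fin (2 ^ N)} {x : ℝ}
    (hx : x ∈ dyadicI N a) : haarFn n m x = haarVal N n m a := by
  simp only [haarFn, haarVal, Set.indicator_apply, mem_dyadicI_iff hn hx]

lemma exists_mem_dyadicI (N : ℕ) {x : ℝ} (hx : x ∈ Set.Ioc (0 : ℝ) 1) :
    ∃ a : Fin (2 ^ N), x ∈ dyadicI N a := by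
  have h2 : (0 : ℝ) < 2 ^ N := by positivity
  have hpos : 0 < ⌈x * 2 ^ N⌉₊ := Nat.ceil_pos.2 (mul_pos hx.1 h2)
  have hle : ⌈x * 2 ^ N⌉₊ ≤ 2 ^ N := by
    rw [Nat.ceil_le]
    push_cast
    nlinarith [hx.2]
  obtain ⟨a, ha⟩ : ∃ a, ⌈x * 2 ^ N⌉₊ = a + 1 := ⟨_, (Nat.succ_pred_eq_of_pos hpos).symm⟩
  refine ⟨⟨a, by omega⟩, ?_⟩
  rw [Nat.ceil_eq_iff (by omega)] at ha
  simp only [dyadicI, Set.mem_Ioc, div_lt_iff₀ h2, le_div_iff₀ h2]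
  exact ⟨by simpa using ha.1, by exact_mod_cast ha.2⟩

lemma dyadicI_subset_Ioc {N a : ℕ} (ha : a < 2 ^ N) : dyadicI N a ⊆ Set.Ioc 0 1 := by
  apply Set.Ioc_subset_Ioc
  · positivity
  · rw [div_le_one (by positivity)]
    exact_mod_cast ha

/-- The dyadic square of side `2^{-N}` with indices `ab`. -/
def dyadicCell (N : ℕ) (ab : Fin (2 ^ N) × Fin (2 ^ N)) : Set (ℝ × ℝ) :=
  dyadicI N ab.1 ×ˢ dyadicI N ab.2

lemma iUnion_dyadicCell (N : ℕ) : ⋃ ab, dyadicCell N ab = unitSq := by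
  ext q
  simp only [Set.mem_iUnion, dyadicCell, unitSq, Set.mem_prod]
  constructor
  · rintro ⟨ab, h1, h2⟩
    exact ⟨dyadicI_subset_Ioc ab.1.2 h1, dyadicI_subset_Ioc ab.2.2 h2⟩
  · rintro ⟨h1, h2⟩
    obtain ⟨a, ha⟩ := exists_mem_dyadicI N h1
    obtain ⟨b, hb⟩ := exists_mem_dyadicI N h2
    exact ⟨(a, b), ha, hb⟩

lemma measurableSet_dyadicCell (N : ℕ) (ab : Fin (2 ^ N) × Fin (2 ^ N)) :
    MeasurableSet (dyadicCell N ab) :=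
  measurableSet_Ioc.prod measurableSet_Ioc

lemma pairwise_disjoint_dyadicCell (N : ℕ) :
    Pairwise (Function.onFun Disjoint (dyadicCell N)) := by
  intro ab ab' hne
  refine Set.disjoint_left.2 fun q h h' => hne ?_
  exact Prod.ext (Fin.ext (dyadicI_index_unique h.1 h'.1)) (Fin.ext (dyadicI_index_unique h.2 h'.2))

lemma volume_dyadicCell (N : ℕ) (ab : Fin (2 ^ N) × Fin (2 ^ N)) :
    volume (dyadicCell N ab) = ENNReal.ofReal ((4 ^ N)⁻¹) := by
  have h : ∀ a : ℕ, volume (dyadicI N a) = ENNReal.ofReal ((2 ^ N)⁻¹) := by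
    intro a
    rw [dyadicI, Real.volume_Ioc]
    congr 1
    ring
  rw [dyadicCell, Measure.volume_eq_prod, Measure.prod_prod, h, h,
    ← ENNReal.ofReal_mul (by positivity), ← mul_inv, ← mul_pow]
  norm_num

lemma setLIntegral_unitSq_eq_sum {N : ℕ} {g : ℝ × ℝ → ENNReal}
    {G : Fin (2 ^ N) × Fin (2 ^ N) → ENNReal} (h : ∀ ab, ∀ q ∈ dyadicCell N ab, g q = G ab) :
    ∫⁻ q in unitSq, g q = (∑ ab, G ab) * ENNReal.ofReal ((4 ^ N)⁻¹) := by
  rw [← iUnion_dyadicCell N, lintegral_iUnion (measurableSet_dyadicCell N)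
    (pairwise_disjoint_dyadicCell N), tsum_fintype, Finset.sum_mul]
  refine Finset.sum_congr rfl fun ab _ => ?_
  rw [setLIntegral_congr_fun (measurableSet_dyadicCell N ab) (h ab), setLIntegral_const,
    volume_dyadicCell]

lemma setIntegral_unitSq_eq_sum {N : ℕ} {g : ℝ × ℝ → ℝ} {G : Fin (2 ^ N) × Fin (2 ^ N) → ℝ}
    (h : ∀ ab, ∀ q ∈ dyadicCell N ab, g q = G ab) :
    ∫ q in unitSq, g q = (∑ ab, G ab) * (4 ^ N)⁻¹ := by
  rw [← iUnion_dyadicCell N, integral_iUnion_fintype (measurableSet_dyadicCell N)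
    (pairwise_disjoint_dyadicCell N), Finset.sum_mul]
  · refine Finset.sum_congr rfl fun ab _ => ?_
    rw [setIntegral_congr_fun (measurableSet_dyadicCell N ab) (h ab), setIntegral_const,
      measureReal_def, volume_dyadicCell, ENNReal.toReal_ofReal (by positivity), smul_eq_mul,
      mul_comm]
  · intro ab
    refine IntegrableOn.congr_fun (f := fun _ => G ab) ?_ (fun q hq => (h ab q hq).symm)
      (measurableSet_dyadicCell N ab)
    exact integrableOn_const (by rw [volume_dyadicCell]; exact ENNReal.ofReal_ne_top)

lemma haar_sum_eq {N : ℕ} {c : ((ℕ × ℕ) × ℕ × ℕ) →₀ ℝ}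
    (hN : ∀ j ∈ c.support, j.1.1 < N ∧ j.2.1 < N) {ab : Fin (2 ^ N) × Fin (2 ^ N)} {q : ℝ × ℝ}
    (hq : q ∈ dyadicCell N ab) :
    (c.sum fun i a => a * haarFn i.1.1 i.1.2 q.1 * haarFn i.2.1 i.2.2 q.2) =
      ∑ i ∈ c.support, c i * haarVal N i.1.1 i.1.2 ab.1 * haarVal N i.2.1 i.2.2 ab.2 :=
  Finset.sum_congr rfl fun j hj => by
    beta_reduce
    rw [haarFn_eq_haarVal (hN j hj).1 _ hq.1, haarFn_eq_haarVal (hN j hj).2 _ hq.2]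

lemma haar_coefficient {f : ℝ × ℝ → ℝ} {c : ((ℕ × ℕ) × ℕ × ℕ) →₀ ℝ}
    (hc : ∀ i ∈ c.support, i.1.2 < 2 ^ i.1.1 ∧ i.2.2 < 2 ^ i.2.1)
    (hf : ∀ q : ℝ × ℝ, f q =
      c.sum fun i a => a * haarFn i.1.1 i.1.2 q.1 * haarFn i.2.1 i.2.2 q.2)
    {i : (ℕ × ℕ) × ℕ × ℕ} (hi : i.1.2 < 2 ^ i.1.1 ∧ i.2.2 < 2 ^ i.2.1) :
    ∫ w in unitSq, f w * haarFn i.1.1 i.1.2 w.1 * haarFn i.2.1 i.2.2 w.2 = c i := by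
  obtain ⟨N, hN⟩ : ∃ N, ∀ j ∈ insert i c.support, j.1.1 < N ∧ j.2.1 < N := by
    refine ⟨(insert i c.support).sup (fun j => j.1.1 + j.2.1) + 1, fun j hj => ?_⟩
    have := Finset.le_sup (f := fun j : (ℕ × ℕ) × ℕ × ℕ => j.1.1 + j.2.1) hj
    beta_reduce at this
    omega
  have hi' := hN i (Finset.mem_insert_self _ _)
  have hN' : ∀ j ∈ c.support, j.1.1 < N ∧ j.2.1 < N := fun j hj =>
    hN j (Finset.mem_insert_of_mem hj)
  rw [setIntegral_unitSq_eq_sum (N := N) (G := fun ab =>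
    (∑ j ∈ c.support, c j * haarVal N j.1.1 j.1.2 ab.1 * haarVal N j.2.1 j.2.2 ab.2) *
      haarVal N i.1.1 i.1.2 ab.1 * haarVal N i.2.1 i.2.2 ab.2)]
  · have h1 : ∑ ab : Fin (2 ^ N) × Fin (2 ^ N),
        (∑ j ∈ c.support, c j * haarVal N j.1.1 j.1.2 ab.1 * haarVal N j.2.1 j.2.2 ab.2) *
          haarVal N i.1.1 i.1.2 ab.1 * haarVal N i.2.1 i.2.2 ab.2 =
        ∑ j ∈ c.support, c j * ((∑ a, haarVal N j.1.1 j.1.2 a * haarVal N i.1.1 i.1.2 a) *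
          ∑ b, haarVal N j.2.1 j.2.2 b * haarVal N i.2.1 i.2.2 b) := by
      simp only [Finset.mul_sum, Finset.sum_mul, Fintype.sum_prod_type]
      rw [Finset.sum_congr rfl fun a _ => Finset.sum_comm, Finset.sum_comm]
      refine Finset.sum_congr rfl fun j _ => Finset.sum_comm.trans <|
        Finset.sum_congr rfl fun b _ => Finset.sum_congr rfl fun a _ => by ring
    have h2 : ∀ j ∈ c.support,
        c j * ((∑ a, haarVal N j.1.1 j.1.2 a * haarVal N i.1.1 i.1.2 a) *
          ∑ b, haarVal N j.2.1 j.2.2 b * haarVal N i.2.1 i.2.2 b) =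
        if j = i then c j * 4 ^ N else 0 := by
      intro j hj
      rw [sum_haarVal_mul_haarVal (hN' j hj).1 (hc j hj).1 hi'.1 hi.1,
        sum_haarVal_mul_haarVal (hN' j hj).2 (hc j hj).2 hi'.2 hi.2]
      by_cases hji : j = i
      · subst hji
        rw [if_pos ⟨rfl, rfl⟩, if_pos ⟨rfl, rfl⟩, if_pos rfl, ← mul_pow]
        norm_num
      · rw [if_neg hji]
        split_ifs with h1 h2
        · exact absurd (Prod.ext (Prod.ext h1.1 h1.2) (Prod.ext h2.1 h2.2)) hji
        all_goals simp
    rw [h1, Finset.sum_congr rfl h2, Finset.sum_ite_eq']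
    split_ifs with h
    · field_simp
    · rw [Finsupp.notMem_support_iff.1 h, zero_mul]
  · intro ab q hq
    rw [hf, haar_sum_eq hN' hq, haarFn_eq_haarVal hi'.1 _ hq.1, haarFn_eq_haarVal hi'.2 _ hq.2]

end DyadicCells

section DyadicLipschitz

lemma add_one_eq_of_inv_two_pow_mem_dyadicI {k n m : ℕ} (hk : k ≤ n)
    (h : ((2 : ℝ) ^ k)⁻¹ ∈ dyadicI n m) : m + 1 = 2 ^ (n - k) := by
  have h2 : (0 : ℝ) < 2 ^ n := by positivity
  have hn : ((2 : ℝ) ^ k)⁻¹ * 2 ^ n = 2 ^ (n - k) := by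
    rw [pow_sub₀ _ two_ne_zero hk, mul_comm]
  simp only [dyadicI, Set.mem_Ioc, div_lt_iff₀ h2, le_div_iff₀ h2, hn] at h
  norm_cast at h
  omega

lemma inv_two_pow_le_dyadDist {k l : ℕ} (hkl : k ≠ l) :
    ((2 : ℝ) ^ k)⁻¹ ≤ dyadDist ((2 : ℝ) ^ k)⁻¹ ((2 : ℝ) ^ l)⁻¹ := by
  have h01 : ∀ j : ℕ, ((2 : ℝ) ^ j)⁻¹ ∈ dyadicI 0 0 := by
    intro j
    refine ⟨by simp, ?_⟩
    simpa using inv_le_one_of_one_le₀ (one_le_pow₀ (one_le_two (α := ℝ)))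
  refine le_csInf ⟨_, 0, 0, by norm_num, h01 k, h01 l, rfl⟩ ?_
  rintro _ ⟨n, m, -, h1, h2, rfl⟩
  refine inv_anti₀ (by positivity) (pow_le_pow_right₀ one_le_two ?_)
  by_contra! hkn
  have hm := add_one_eq_of_inv_two_pow_mem_dyadicI hkn.le h1
  rcases le_or_gt l n with hln | hnl
  · have hm' := add_one_eq_of_inv_two_pow_mem_dyadicI hln h2
    have := Nat.pow_right_injective le_rfl (hm.symm.trans hm')
    omega
  · have h3 : (m : ℝ) < 1 := by
      have h4 := h2.1
      rw [div_lt_iff₀ (by positivity)] at h4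
      refine h4.trans_le ?_
      rw [inv_mul_le_iff₀ (by positivity), mul_one]
      exact pow_le_pow_right₀ one_le_two hnl.le
    have h5 : m = 0 := by
      norm_cast at h3
      omega
    have h6 : 1 < 2 ^ (n - k) := Nat.one_lt_two_pow (by omega)
    omega

lemma dyadDist2_le {q q' : ℝ × ℝ} {n m m' : ℕ} (hm : m < 2 ^ n) (hm' : m' < 2 ^ n)
    (h1 : q.1 ∈ dyadicI n m) (h1' : q'.1 ∈ dyadicI n m) (h2 : q.2 ∈ dyadicI n m')
    (h2' : q'.2 ∈ dyadicI n m') : dyadDist2 q q' ≤ ((2 : ℝ) ^ n)⁻¹ := by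
  refine csInf_le ⟨0, ?_⟩ ⟨n, m, m', hm, hm', h1, h1', h2, h2', rfl⟩
  rintro _ ⟨_, _, _, _, _, _, _, _, _, rfl⟩
  positivity

lemma scale_eq_of_mem_dyadic_square {v : ℝ × ℝ → ℝ} {κ : ℝ × ℝ → ℕ}
    (hκ : ∀ q ∈ unitSq, v q = ((2 : ℝ) ^ κ q)⁻¹)
    (hL : ∀ q ∈ unitSq, ∀ q' ∈ unitSq, dyadDist (v q) (v q') ≤ (1 / 2) * dyadDist2 q q')
    {q q' : ℝ × ℝ} {n m m' : ℕ} (hm : m < 2 ^ n) (hm' : m' < 2 ^ n)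
    (h1 : q.1 ∈ dyadicI n m) (h1' : q'.1 ∈ dyadicI n m) (h2 : q.2 ∈ dyadicI n m')
    (h2' : q'.2 ∈ dyadicI n m') (hk : κ q ≤ n) : κ q' = κ q := by
  by_contra hne
  have hq : q ∈ unitSq := ⟨dyadicI_subset_Ioc hm h1, dyadicI_subset_Ioc hm' h2⟩
  have hq' : q' ∈ unitSq := ⟨dyadicI_subset_Ioc hm h1', dyadicI_subset_Ioc hm' h2'⟩
  have h3 := hL q hq q' hq'
  rw [hκ q hq, hκ q' hq'] at h3
  have h4 := inv_two_pow_le_dyadDist (Ne.symm hne)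
  have h5 := dyadDist2_le hm hm' h1 h1' h2 h2'
  have h6 : ((2 : ℝ) ^ n)⁻¹ ≤ ((2 : ℝ) ^ κ q)⁻¹ :=
    inv_anti₀ (by positivity) (pow_le_pow_right₀ one_le_two hk)
  have h7 : (0 : ℝ) < ((2 : ℝ) ^ n)⁻¹ := by positivity
  linarith

end DyadicLipschitz

lemma dyadicHilbert_eq_sum {v f : ℝ × ℝ → ℝ} {c : ((ℕ × ℕ) × ℕ × ℕ) →₀ ℝ}
    (hc : ∀ i ∈ c.support, i.1.2 < 2 ^ i.1.1 ∧ i.2.2 < 2 ^ i.2.1)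
    (hf : ∀ q : ℝ × ℝ, f q =
      c.sum fun i a => a * haarFn i.1.1 i.1.2 q.1 * haarFn i.2.1 i.2.2 q.2)
    {q : ℝ × ℝ} {k : ℕ} (hv : v q = ((2 : ℝ) ^ k)⁻¹) :
    dyadicHilbert v f q = ∑ i ∈ c.support, if i.1.1 + k ≤ i.2.1 then
      c i * haarFn i.1.1 i.1.2 q.1 * haarFn i.2.1 i.2.2 q.2 else 0 := by
  rw [dyadicHilbert, tsum_eq_sum (s := c.support)]
  · refine Finset.sum_congr rfl fun i hi => ?_
    rw [haar_coefficient hc hf (hc i hi)]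
    refine if_congr ?_ rfl rfl
    rw [and_iff_right (hc i hi).1, and_iff_right (hc i hi).2, hv, div_inv_eq_mul,
      inv_mul_le_iff₀ (by positivity), le_mul_inv_iff₀ (by positivity), ← pow_add]
    exact pow_le_pow_iff_right₀ one_lt_two
  · intro i hi
    refine ite_eq_right_iff.2 fun h => ?_
    rw [haar_coefficient hc hf ⟨h.1, h.2.1⟩, Finsupp.notMem_support_iff.1 hi, zero_mul, zero_mul]

lemma lintegral_enorm_rpow_eq_sum {N : ℕ} {p : ℝ} (hp : 0 ≤ p) {g : ℝ × ℝ → ℝ}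
    {G : Fin (2 ^ N) → Fin (2 ^ N) → ℝ}
    (h : ∀ ab, ∀ q ∈ dyadicCell N ab, g q = G ab.1 ab.2) :
    ∫⁻ q in unitSq, ‖g q‖ₑ ^ p =
      ENNReal.ofReal (∑ a, ∑ b, |G a b| ^ p) * ENNReal.ofReal ((4 ^ N)⁻¹) := by
  rw [setLIntegral_unitSq_eq_sum (G := fun ab => ENNReal.ofReal (|G ab.1 ab.2| ^ p)),
    ← ENNReal.ofReal_sum_of_nonneg fun _ _ => by positivity, Fintype.sum_prod_type]
  intro ab q hq
  rw [h ab q hq, Real.enorm_eq_ofReal_abs, ENNReal.ofReal_rpow_of_nonneg (abs_nonneg _) hp]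

/-- Dyadic model theorem: if `v : (0,1]² → (0,1]` takes values in `{2^{-k} : k ∈ ℕ}` and is
Lipschitz with constant at most `1/2` for the dyadic metrics, then for every `1 < p < ∞`
the operator `H_{v,D}` is bounded on `L^p((0,1]²)`, with constant depending only on `p`,
on finite linear combinations `f` of tensor Haar functions. -/
theorem stmt_2 (p : ℝ) (hp : 1 < p) :
    ∃ C : ℝ, 0 < C ∧
      ∀ v : ℝ × ℝ → ℝ,
        (∀ q ∈ unitSq, ∃ k : ℕ, v q = (2 : ℝ) ^ (-(k : ℤ))) →
        (∀ q ∈ unitSq, ∀ q' ∈ unitSq, dyadDist (v q) (v q') ≤ (1 / 2) * dyadDist2 q q') →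
        ∀ f : ℝ × ℝ → ℝ,
          (∃ c : ((ℕ × ℕ) × ℕ × ℕ) →₀ ℝ,
            (∀ i ∈ c.support, i.1.2 < 2 ^ i.1.1 ∧ i.2.2 < 2 ^ i.2.1) ∧
            ∀ q : ℝ × ℝ, f q =
              c.sum fun i a => a * haarFn i.1.1 i.1.2 q.1 * haarFn i.2.1 i.2.2 q.2) →
          eLpNorm (dyadicHilbert v f) (ENNReal.ofReal p) (volume.restrict unitSq) ≤
            ENNReal.ofReal C * eLpNorm f (ENNReal.ofReal p) (volume.restrict unitSq) := by
  have hp0 : 0 < p := by linarith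
  obtain ⟨K, hK, hbound⟩ := exists_discrete_bound hp
  refine ⟨K ^ (1 / p), by positivity, ?_⟩
  rintro v hv hL f ⟨c, hc, hf⟩
  choose! κ hκ using hv
  have hκ' : ∀ q ∈ unitSq, v q = ((2 : ℝ) ^ κ q)⁻¹ := fun q hq => by
    rw [hκ q hq, zpow_neg, zpow_natCast]
  obtain ⟨N, hN⟩ : ∃ N, ∀ j ∈ c.support, j.1.1 < N ∧ j.2.1 < N := by
    refine ⟨c.support.sup (fun j => j.1.1 + j.2.1) + 1, fun j hj => ?_⟩
    have := Finset.le_sup (f := fun j : (ℕ × ℕ) × ℕ × ℕ => j.1.1 + j.2.1) hj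
    beta_reduce at this
    omega
  have hnode : ∀ a : Fin (2 ^ N), (((a : ℕ) : ℝ) + 1) / 2 ^ N ∈ dyadicI N a := fun a =>
    ⟨div_lt_div_of_pos_right (lt_add_one _) (by positivity), le_rfl⟩
  have hscale : ∀ {n : ℕ}, n < N → ∀ {a b b' : Fin (2 ^ N)} {q q' : ℝ × ℝ},
      q ∈ dyadicCell N (a, b) → q' ∈ dyadicCell N (a, b') →
      dyadicBlock N n b = dyadicBlock N n b' → κ q ≤ n → κ q' = κ q := by
    intro n hn a b b' q q' hq hq' hb hk
    refine scale_eq_of_mem_dyadic_square hκ' hL (dyadicBlock_lt hn.le a) (dyadicBlock_lt hn.le b)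
      (dyadicI_subset hn.le a hq.1) (dyadicI_subset hn.le a hq'.1) (dyadicI_subset hn.le b hq.2)
      ?_ hk
    rw [hb]
    exact dyadicI_subset hn.le b' hq'.2
  set κN : Fin (2 ^ N) → Fin (2 ^ N) → ℕ := fun a b =>
    κ ((((a : ℕ) : ℝ) + 1) / 2 ^ N, (((b : ℕ) : ℝ) + 1) / 2 ^ N) with hκN
  have hdisc := hbound N c.support c κN
    (fun i hi => ⟨⟨(hN i hi).1, (hc i hi).1⟩, (hN i hi).2, (hc i hi).2⟩)
    (fun n hn a b b' hb hk => hscale hn ⟨hnode a, hnode b⟩ ⟨hnode a, hnode b'⟩ hb hk)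
  have hH : ∀ ab, ∀ q ∈ dyadicCell N ab, dyadicHilbert v f q =
      ∑ i ∈ c.support, if i.1.1 + κN ab.1 ab.2 ≤ i.2.1 then
        c i * haarVal N i.1.1 i.1.2 ab.1 * haarVal N i.2.1 i.2.2 ab.2 else 0 := by
    rintro ⟨a, b⟩ q hq
    have hqS : q ∈ unitSq := iUnion_dyadicCell N ▸ Set.mem_iUnion.2 ⟨_, hq⟩
    rw [dyadicHilbert_eq_sum hc hf (hκ' q hqS)]
    refine Finset.sum_congr rfl fun i hi => ?_
    rw [haarFn_eq_haarVal (hN i hi).1 _ hq.1, haarFn_eq_haarVal (hN i hi).2 _ hq.2]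
    refine if_congr ?_ rfl rfl
    have hnq : ((((a : ℕ) : ℝ) + 1) / 2 ^ N, (((b : ℕ) : ℝ) + 1) / 2 ^ N) ∈ dyadicCell N (a, b) :=
      ⟨hnode a, hnode b⟩
    constructor
    · intro h
      have := hscale (hN i hi).2 hq hnq rfl (by omega)
      simp only [hκN]
      omega
    · intro h
      simp only [hκN] at h
      have := hscale (hN i hi).2 hnq hq rfl (by omega)
      omega
  have hF : ∀ ab, ∀ q ∈ dyadicCell N ab, f q =
      ∑ i ∈ c.support, c i * haarVal N i.1.1 i.1.2 ab.1 * haarVal N i.2.1 i.2.2 ab.2 :=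
    fun ab q hq => (hf q).trans (haar_sum_eq hN hq)
  rw [eLpNorm_eq_lintegral_rpow_enorm_toReal (by simpa using hp0) ENNReal.ofReal_ne_top,
    eLpNorm_eq_lintegral_rpow_enorm_toReal (by simpa using hp0) ENNReal.ofReal_ne_top,
    ENNReal.toReal_ofReal hp0.le, ← ENNReal.ofReal_rpow_of_nonneg hK.le (by positivity),
    ← ENNReal.mul_rpow_of_nonneg _ _ (by positivity)]
  refine ENNReal.rpow_le_rpow ?_ (by positivity)
  rw [lintegral_enorm_rpow_eq_sum hp0.le (G := fun a b => ∑ i ∈ c.support,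
      if i.1.1 + κN a b ≤ i.2.1 then
        c i * haarVal N i.1.1 i.1.2 a * haarVal N i.2.1 i.2.2 b else 0) hH,
    lintegral_enorm_rpow_eq_sum hp0.le (G := fun a b => ∑ i ∈ c.support,
      c i * haarVal N i.1.1 i.1.2 a * haarVal N i.2.1 i.2.2 b) hF, ← mul_assoc,
    ← ENNReal.ofReal_mul hK.le]
  gcongr
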